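/- If the nonlinear Volterra equation V(t) = ∫_{[0,t]} W′(t−s) μ(ds) − ∫₀^t (𝓡∘V)(s)·W′(t−s) ds admits an L^∞_loc-noncontinuable solution, then it admits a unique global solution V_μ in the space of nonnegative càdlàg functions on [0,∞) (satisfying the equation for every t ≥ 0), and this solution satisfies 0 ≤ V_μ(t) ≤ μ([0,t])/c for all t ≥ 0. -/

import Mathlib

open MeasureTheory Real Set Filter Topology

noncomputable def tailNu (ν : Measure ℝ) (y : ℝ) : ℝ := (ν (Set.Ici y)).toReal

noncomputable def itailNu (ν : Measure ℝ) (x : ℝ) : ℝ := ∫ y in Set.Ioi x, tailNu ν y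

noncomputable def phi (b c : ℝ) (ν : Measure ℝ) (l : ℝ) : ℝ :=
  b * l + c * l ^ 2 + ∫ y in Set.Ioi (0 : ℝ), (Real.exp (-l * y) - 1 + l * y) ∂ν

/-- The nonlinear operator `𝓡`. -/
noncomputable def Rop (c : ℝ) (ν : Measure ℝ) (f : ℝ → ℝ) (t : ℝ) : ℝ :=
  c * f t ^ 2 + ∫ y in Set.Ioi (0 : ℝ),
    (Real.exp (-(∫ r in (max (t - y) 0)..t, f r)) - 1 + ∫ r in (max (t - y) 0)..t, f r) ∂ν

/-- Nonnegative on `[0,∞)` and càdlàg there: right-continuous at every `t ≥ 0` and with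
left limits at every `t > 0`. -/
def CadlagNonneg (V : ℝ → ℝ) : Prop :=
  (∀ t : ℝ, 0 ≤ t → 0 ≤ V t) ∧
  (∀ t : ℝ, 0 ≤ t → ContinuousWithinAt V (Set.Ici t) t) ∧
  (∀ t : ℝ, 0 < t → ∃ l : ℝ, Filter.Tendsto V (nhdsWithin t (Set.Iio t)) (nhds l))

/-- The right-hand side of the nonlinear Volterra equation
`V(t) = ∫_{[0,t]} W′(t−s) μ(ds) − ∫₀^t (𝓡∘V)(s)·W′(t−s) ds`. -/
noncomputable def volterraRHS (c : ℝ) (ν μ : Measure ℝ) (W' V : ℝ → ℝ) (t : ℝ) : ℝ :=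
  (∫ s in Set.Icc (0 : ℝ) t, W' (t - s) ∂μ) -
    ∫ s in (0 : ℝ)..t, Rop c ν V s * W' (t - s)

open scoped ENNReal

section
open ProbabilityTheory

lemma laplace_ext (α β : Measure ℝ)
    (hfin : ∀ l : ℝ, 0 < l → ∫⁻ x, ENNReal.ofReal (rexp (-l * x)) ∂α ≠ ⊤)
    (heq : ∀ l : ℝ, 0 < l → ∫⁻ x, ENNReal.ofReal (rexp (-l * x)) ∂α
      = ∫⁻ x, ENNReal.ofReal (rexp (-l * x)) ∂β) : α = β := by
  have key : ∀ γ : Measure ℝ, ∀ t : ℝ, 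
      ∫⁻ x, ENNReal.ofReal (rexp (t * x)) ∂(γ.withDensity (fun x => ENNReal.ofReal (rexp (-1 * x))))
       = ∫⁻ x, ENNReal.ofReal (rexp (-(1 - t) * x)) ∂γ := by
    intro γ t
    rw [lintegral_withDensity_eq_lintegral_mul _ (by fun_prop) (by fun_prop)]
    refine lintegral_congr fun x => ?_
    simp only [Pi.mul_apply]
    rw [← ENNReal.ofReal_mul (by positivity), ← Real.exp_add]
    congr 2; ring
  have hback : ∀ γ : Measure ℝ, (γ.withDensity (fun x => ENNReal.ofReal (rexp (-1 * x)))).withDensity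
      (fun x => ENNReal.ofReal (rexp x)) = γ := by
    intro γ
    rw [← withDensity_mul _ (by fun_prop) (by fun_prop)]
    have : ((fun x : ℝ => ENNReal.ofReal (rexp (-1 * x))) * fun x => ENNReal.ofReal (rexp x)) = 1 := by
      ext x
      simp only [Pi.mul_apply, Pi.one_apply]
      rw [← ENNReal.ofReal_mul (by positivity), ← Real.exp_add]
      simp
    rw [this, withDensity_one]
  set α1 := α.withDensity (fun x => ENNReal.ofReal (rexp (-1 * x))) with hα1
  set β1 := β.withDensity (fun x => ENNReal.ofReal (rexp (-1 * x))) with hβ1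
  have hfinα : ∀ t : ℝ, t < 1 → ∫⁻ x, ENNReal.ofReal (rexp (t * x)) ∂α1 ≠ ⊤ := by
    intro t ht
    rw [key]; exact hfin _ (by linarith)
  have heq1 : ∀ t : ℝ, t < 1 → ∫⁻ x, ENNReal.ofReal (rexp (t * x)) ∂α1 =
      ∫⁻ x, ENNReal.ofReal (rexp (t * x)) ∂β1 := by
    intro t ht
    rw [key, key]; exact heq _ (by linarith)
  have hint : ∀ γ : Measure ℝ, ∀ t : ℝ, ∫⁻ x, ENNReal.ofReal (rexp (t * x)) ∂γ ≠ ⊤ → 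
      Integrable (fun x => rexp (t * x)) γ := by
    intro γ t h
    refine ⟨by fun_prop, ?_⟩
    rw [hasFiniteIntegral_iff_ofReal (ae_of_all _ fun x => by positivity)]
    exact h.lt_top
  have hsubα : Iio (1 : ℝ) ⊆ interior (integrableExpSet id α1) := by
    refine interior_maximal (fun t ht => ?_) isOpen_Iio
    exact hint _ t (hfinα t ht)
  have hsubβ : Iio (1 : ℝ) ⊆ interior (integrableExpSet id β1) := by
    refine interior_maximal (fun t ht => ?_) isOpen_Iio
    exact hint _ t (heq1 t ht ▸ hfinα t ht)
  have : IsFiniteMeasure α1 := by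
    refine ⟨?_⟩
    have := hfinα 0 (by norm_num)
    simpa [lt_top_iff_ne_top] using this
  have : IsFiniteMeasure β1 := by
    refine ⟨?_⟩
    have := heq1 0 (by norm_num) ▸ hfinα 0 (by norm_num)
    simpa [lt_top_iff_ne_top] using this
  have hmgf : ∀ t : ℝ, t < 1 → mgf id α1 t = mgf id β1 t := by
    intro t ht
    simp only [mgf, id]
    rw [integral_eq_lintegral_of_nonneg_ae (ae_of_all _ fun x => by positivity) (by fun_prop),
      integral_eq_lintegral_of_nonneg_ae (ae_of_all _ fun x => by positivity) (by fun_prop),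
      heq1 t ht]
  have hA : AnalyticOnNhd ℂ (complexMGF id α1) {z | z.re < 1} :=
    (analyticOnNhd_complexMGF).mono (fun z hz => hsubα hz)
  have hB : AnalyticOnNhd ℂ (complexMGF id β1) {z | z.re < 1} :=
    (analyticOnNhd_complexMGF).mono (fun z hz => hsubβ hz)
  have hE : Set.EqOn (complexMGF id α1) (complexMGF id β1) {z | z.re < 1} := by
    refine AnalyticOnNhd.eqOn_of_preconnected_of_frequently_eq hA hB
      (((convex_Iio (1:ℝ)).linear_preimage Complex.reLm).isPreconnected)
      (z₀ := ((0:ℝ) : ℂ)) (by simp) ?_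
    have h_real : ∃ᶠ (x : ℝ) in 𝓝[≠] 0, complexMGF id α1 x = complexMGF id β1 x := by
      refine Eventually.frequently ?_
      have : ∀ᶠ x : ℝ in 𝓝[≠] 0, x < 1 := nhdsWithin_le_nhds (Iio_mem_nhds (by norm_num))
      filter_upwards [this] with y hy
      rw [complexMGF_ofReal, complexMGF_ofReal, hmgf y hy]
    rw [frequently_iff_seq_forall] at h_real ⊢
    obtain ⟨xs, hx_tendsto, hx_eq⟩ := h_real
    refine ⟨fun n ↦ xs n, ?_, fun n ↦ ?_⟩
    · rw [tendsto_nhdsWithin_iff] at hx_tendsto ⊢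
      constructor
      · exact (Complex.continuous_ofReal.tendsto 0).comp hx_tendsto.1
      · simpa using hx_tendsto.2
    · simp [hx_eq]
  have : α1 = β1 := by
    apply Measure.ext_of_charFun
    ext t
    rw [← complexMGF_id_mul_I, ← complexMGF_id_mul_I]
    exact hE (by simp)
  rw [← hback α, ← hback β, ← hα1, ← hβ1, this]

/-- convolution of a function with a measure -/
noncomputable def cv (f : ℝ → ℝ≥0∞) (ρ : Measure ℝ) (t : ℝ) : ℝ≥0∞ := ∫⁻ s, f (t - s) ∂ρ

lemma cv_meas {f : ℝ → ℝ≥0∞} (hf : Measurable f) (ρ : Measure ℝ) [SFinite ρ] :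
    Measurable (cv f ρ) := by
  unfold cv
  fun_prop

lemma conv_dens {f : ℝ → ℝ≥0∞} (hf : Measurable f) (ρ : Measure ℝ) [SFinite ρ] :
    (volume.withDensity f).conv ρ = volume.withDensity (cv f ρ) := by
  ext s hs
  rw [withDensity_apply _ hs, ← lintegral_indicator_one hs, 
    Measure.lintegral_conv (measurable_one.indicator hs),
    lintegral_lintegral_swap]
  swap
  · exact ((measurable_one.indicator hs).comp (measurable_fst.add measurable_snd)).aemeasurable
  have h1 : ∀ y : ℝ, ∫⁻ x, s.indicator (1 : ℝ → ℝ≥0∞) (x + y) ∂(volume.withDensity f)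
      = ∫⁻ t, s.indicator (1 : ℝ → ℝ≥0∞) t * f (t - y) := by
    intro y
    have hm : Measurable (fun x => s.indicator (1 : ℝ → ℝ≥0∞) (x + y)) :=
      (measurable_one.indicator hs).comp (measurable_id.add_const y)
    rw [lintegral_withDensity_eq_lintegral_mul _ hf hm,
      ← lintegral_add_right_eq_self (fun t => s.indicator (1 : ℝ → ℝ≥0∞) t * f (t - y)) y]
    refine lintegral_congr fun x => ?_
    simp [mul_comm]
  simp_rw [h1]
  rw [lintegral_lintegral_swap, ← lintegral_indicator hs]
  · refine lintegral_congr fun t => ?_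
    by_cases ht : t ∈ s <;> simp [ht, cv]
  · refine Measurable.aemeasurable ?_
    exact ((measurable_one.indicator hs).comp measurable_snd).mul 
      (hf.comp (measurable_snd.sub measurable_fst))

noncomputable def one0 : ℝ → ℝ≥0∞ := (Ici (0:ℝ)).indicator 1

lemma one0_meas : Measurable one0 := measurable_one.indicator measurableSet_Ici

noncomputable def ell : Measure ℝ := volume.withDensity one0

instance : SFinite ell := by unfold ell; infer_instance

lemma cv_one0 (ρ : Measure ℝ) (t : ℝ) : cv one0 ρ t = ρ (Iic t) := by
  unfold cv
  rw [← lintegral_indicator_one measurableSet_Iic]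
  refine lintegral_congr fun s => ?_
  by_cases h : s ≤ t <;> simp [one0, indicator, h]

lemma ell_conv (ρ : Measure ℝ) [SFinite ρ] :
    ell.conv ρ = volume.withDensity (fun t => ρ (Iic t)) := by
  unfold ell
  rw [conv_dens one0_meas]
  congr 1; ext t; exact cv_one0 ρ t

lemma meas_Iic (ρ : Measure ℝ) : Measurable (fun t => ρ (Iic t)) :=
  Monotone.measurable (fun _ _ h => measure_mono (Iic_subset_Iic.2 h))

/-- every point is a decreasing limit of points of a conull set -/
lemma seq_right {p : ℝ → Prop} (h : ∀ᵐ t, p t) (t : ℝ) :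
    ∃ u : ℕ → ℝ, StrictAnti u ∧ (∀ n, t < u n) ∧ (∀ n, p (u n)) ∧ Tendsto u atTop (𝓝 t) := by
  have hd : Dense {t | p t} := by
    exact Measure.dense_of_ae h
  obtain ⟨u, h1, h2, h3⟩ := hd.exists_seq_strictAnti_tendsto t
  exact ⟨u, h1, fun n => (h2 n).1, fun n => (h2 n).2, h3⟩

lemma ell_cancel {α β : Measure ℝ} [SFinite α] [SFinite β] (hα : ∀ t, α (Iic t) ≠ ⊤)
    (hβ : ∀ t, β (Iic t) ≠ ⊤) 
    (h : ell.conv α = ell.conv β) : α = β := by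
  rw [ell_conv, ell_conv, withDensity_eq_iff_of_sigmaFinite (meas_Iic _).aemeasurable
    (meas_Iic _).aemeasurable] at h
  have hall : ∀ t, α (Iic t) = β (Iic t) := by
    intro t
    obtain ⟨u, h1, h2, h3, h4⟩ := seq_right h t
    have hI : Iic t = ⋂ n, Iic (u n) := by
      ext x
      simp only [mem_Iic, mem_iInter]
      refine ⟨fun hx n => hx.trans (h2 n).le, fun hx => ge_of_tendsto' h4 hx⟩
    have ha : Antitone (fun n => Iic (u n)) := fun m n hmn => Iic_subset_Iic.2 (h1.antitone hmn)
    rw [hI, ha.measure_iInter (fun n => measurableSet_Iic.nullMeasurableSet) ⟨0, hα _⟩,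
      ha.measure_iInter (fun n => measurableSet_Iic.nullMeasurableSet) ⟨0, hβ _⟩]
    exact iInf_congr h3
  refine Measure.ext_of_Ioc' α β (fun a b _ => ?_) (fun a b hab => ?_)
  · exact ne_top_of_le_ne_top (hα b) (measure_mono Ioc_subset_Iic_self)
  · rw [← Iic_sdiff_Iic, measure_sdiff (Iic_subset_Iic.2 hab.le) measurableSet_Iic.nullMeasurableSet (hα a),
      measure_sdiff (Iic_subset_Iic.2 hab.le) measurableSet_Iic.nullMeasurableSet (hβ a), hall, hall]

end

section
open ProbabilityTheory

noncomputable def lap (γ : Measure ℝ) (l : ℝ) : ℝ≥0∞ := ∫⁻ x, ENNReal.ofReal (rexp (-l * x)) ∂γ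

lemma lap_conv (α β : Measure ℝ) [SFinite α] [SFinite β] (l : ℝ) :
    lap (α.conv β) l = lap α l * lap β l := by
  unfold lap
  rw [Measure.lintegral_conv (by fun_prop)]
  have : ∀ x y : ℝ, ENNReal.ofReal (rexp (-l * (x + y))) =
      ENNReal.ofReal (rexp (-l * x)) * ENNReal.ofReal (rexp (-l * y)) := by
    intro x y
    rw [← ENNReal.ofReal_mul (by positivity), ← Real.exp_add]; congr 2; ring
  simp_rw [this]
  rw [lintegral_congr (fun x => lintegral_const_mul _ (by fun_prop)), lintegral_mul_const _ (by fun_prop)]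

noncomputable def nn (y x : ℝ) : ℝ≥0∞ := one0 x * ENNReal.ofReal (y - x)

lemma nn_meas : Measurable (fun p : ℝ × ℝ => nn p.1 p.2) := by
  unfold nn
  exact (one0_meas.comp measurable_snd).mul (by fun_prop)

lemma lap_nn (l y : ℝ) (hl : 0 < l) (hy : 0 < y) :
    ∫⁻ x, ENNReal.ofReal (rexp (-l * x)) * nn y x = 
      ENNReal.ofReal ((rexp (-l * y) - 1 + l * y) / l ^ 2) := by
  have h1 : ∀ x, ENNReal.ofReal (rexp (-l * x)) * nn y x = 
      (Ioc 0 y).indicator (fun x => ENNReal.ofReal (rexp (-l * x) * (y - x))) x ∨ x = 0 := by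
    intro x
    rcases lt_trichotomy x 0 with h | h | h
    · left; simp [nn, one0, indicator, h.not_ge, h.not_gt]
    · right; exact h
    · left
      by_cases h2 : x ≤ y
      · simp [nn, one0, indicator, h.le, h, h2, ENNReal.ofReal_mul (Real.exp_pos _).le]
      · have : ENNReal.ofReal (y - x) = 0 := ENNReal.ofReal_of_nonpos (by linarith)
        simp [nn, h2, this]
  have h2 : ∫⁻ x, ENNReal.ofReal (rexp (-l * x)) * nn y x = 
      ∫⁻ x in Ioc 0 y, ENNReal.ofReal (rexp (-l * x) * (y - x)) := by
    rw [← lintegral_indicator measurableSet_Ioc]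
    refine lintegral_congr_ae ?_
    have : ∀ᵐ x : ℝ, x ≠ 0 := by simp [ae_iff]
    filter_upwards [this] with x hx
    exact (h1 x).resolve_right hx
  rw [h2, ← ofReal_integral_eq_lintegral_ofReal, ← intervalIntegral.integral_of_le hy.le]
  · congr 1
    rw [intervalIntegral.integral_eq_sub_of_hasDerivAt 
      (f := fun x => rexp (-l * x) * (-(y - x) / l + 1 / l ^ 2))]
    · simp only [sub_self, mul_zero, Real.exp_zero]
      field_simp
      ring
    · intro x _
      have a1 : HasDerivAt (fun x => rexp (-l * x)) (rexp (-l * x) * (-l * 1)) x :=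
        ((hasDerivAt_id x).const_mul (-l)).exp
      have a2 : HasDerivAt (fun x => -(y - x) / l + 1 / l ^ 2) (-(-1) / l) x :=
        ((((hasDerivAt_id x).const_sub y).neg).div_const l).add_const _
      refine (a1.mul a2).congr_deriv ?_
      have : l ≠ 0 := hl.ne'
      field_simp
      ring
    · exact Continuous.intervalIntegrable (by fun_prop) _ _
  · exact (Continuous.integrableOn_Icc (by fun_prop)).mono_set Ioc_subset_Icc_self
  · refine (ae_restrict_iff' measurableSet_Ioc).2 (ae_of_all _ fun x hx => ?_)
    exact mul_nonneg (Real.exp_pos _).le (by linarith [hx.2])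

lemma lap_ell (l : ℝ) (hl : 0 < l) : lap ell l = ENNReal.ofReal (1 / l) := by
  unfold lap ell
  rw [lintegral_withDensity_eq_lintegral_mul _ one0_meas (by fun_prop)]
  have : ∀ x, (one0 * fun x => ENNReal.ofReal (rexp (-l * x))) x = 
      (Ici 0).indicator (fun x => ENNReal.ofReal (rexp (-l * x))) x := by
    intro x
    by_cases h : 0 ≤ x <;> simp [one0, indicator, h]
  rw [lintegral_congr this, lintegral_indicator measurableSet_Ici, 
    setLIntegral_congr Ioi_ae_eq_Ici.symm,
    ← ofReal_integral_eq_lintegral_ofReal (integrableOn_exp_mul_Ioi (by linarith) 0) (ae_of_all _ fun x => by positivity),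
    integral_exp_mul_Ioi (by linarith)]
  congr 1; simp

noncomputable def kd (b : ℝ) (ν : Measure ℝ) (x : ℝ) : ℝ≥0∞ :=
  ENNReal.ofReal b * one0 x + ∫⁻ y, nn y x ∂ν

lemma kd_meas (b : ℝ) (ν : Measure ℝ) [SFinite ν] : Measurable (kd b ν) := by
  unfold kd
  refine (one0_meas.const_mul _).add ?_
  exact Measurable.lintegral_prod_left' nn_meas

noncomputable def kk (b c : ℝ) (ν : Measure ℝ) : Measure ℝ :=
  ENNReal.ofReal c • Measure.dirac 0 + volume.withDensity (kd b ν)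

instance (b c : ℝ) (ν : Measure ℝ) : SFinite (kk b c ν) := by unfold kk; infer_instance

/-- elementary bound -/
lemma phi_le (x : ℝ) (hx : 0 ≤ x) : rexp (-x) - 1 + x ≤ min x (x ^ 2) := by
  refine le_min ?_ ?_
  · have : rexp (-x) ≤ 1 := Real.exp_le_one_iff.2 (by linarith)
    linarith
  · by_cases h : x ≤ 1
    · have := Real.abs_exp_sub_one_sub_id_le (x := -x) (by rw [abs_neg, abs_of_nonneg hx]; exact h)
      have := (abs_le.1 this).2
      nlinarith
    · have : rexp (-x) ≤ 1 := Real.exp_le_one_iff.2 (by linarith)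
      nlinarith

lemma phi_nonneg (x : ℝ) : 0 ≤ rexp (-x) - 1 + x := by
  linarith [Real.add_one_le_exp (-x)]

lemma min_scale (y L : ℝ) (hy : 0 < y) (hL : 0 ≤ L) : 
    min (L * y) ((L * y) ^ 2) ≤ (L + L ^ 2) * min y (y ^ 2) := by
  rcases le_total y (y ^ 2) with h | h
  · rw [min_eq_left h]
    refine (min_le_left _ _).trans ?_
    nlinarith [mul_nonneg (sq_nonneg L) hy.le]
  · rw [min_eq_right h]
    refine (min_le_right _ _).trans ?_
    nlinarith [mul_nonneg hL (sq_nonneg y)]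

lemma integrable_min {ν : Measure ℝ} 
    (hνint : ∫⁻ y in Set.Ioi (0 : ℝ), ENNReal.ofReal (min y (y ^ 2)) ∂ν ≠ ⊤) :
    Integrable (fun y : ℝ => min y (y ^ 2)) (ν.restrict (Ioi 0)) := by
  refine ⟨by fun_prop, ?_⟩
  rw [hasFiniteIntegral_iff_ofReal]
  · exact hνint.lt_top
  · refine (ae_restrict_iff' measurableSet_Ioi).2 (ae_of_all _ fun x hx => ?_)
    exact le_min (le_of_lt hx) (sq_nonneg x)

lemma sfinite_nu {ν : Measure ℝ} 
    (hνint : ∫⁻ y in Set.Ioi (0 : ℝ), ENNReal.ofReal (min y (y ^ 2)) ∂ν ≠ ⊤) :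
    SFinite (ν.restrict (Ioi 0)) := by
  set f : ℝ → ℝ≥0∞ := fun y => ENNReal.ofReal (min y (y ^ 2)) with hf
  have hfm : Measurable f := by fun_prop
  have hfin : IsFiniteMeasure ((ν.restrict (Ioi 0)).withDensity f) := 
    isFiniteMeasure_withDensity hνint
  have h := withDensity_inv_same (μ := ν.restrict (Ioi 0)) hfm (by
    refine (ae_restrict_iff' measurableSet_Ioi).2 (ae_of_all _ fun x hx => ?_)
    simp only [hf, ne_eq, ENNReal.ofReal_eq_zero, not_le]
    exact lt_min hx (pow_pos hx 2)) (ae_of_all _ fun x => by simp [hf])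
  rw [← h]
  infer_instance

lemma lap_kk (b c : ℝ) (hb : 0 ≤ b) (hc : 0 < c) (ν : Measure ℝ) 
    (hνint : ∫⁻ y in Set.Ioi (0 : ℝ), ENNReal.ofReal (min y (y ^ 2)) ∂ν ≠ ⊤) (l : ℝ) (hl : 0 < l) :
    lap (kk b c (ν.restrict (Ioi 0))) l = ENNReal.ofReal (phi b c ν l / l ^ 2) := by
  have := sfinite_nu hνint
  unfold lap kk
  rw [lintegral_add_measure, lintegral_smul_measure, lintegral_dirac,
    lintegral_withDensity_eq_lintegral_mul _ (kd_meas _ _) (by fun_prop)]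
  have h1 : ∀ x, (kd b (ν.restrict (Ioi 0)) * fun x => ENNReal.ofReal (rexp (-l * x))) x =
      ENNReal.ofReal b * (one0 * (fun x => ENNReal.ofReal (rexp (-l * x)))) x 
      + ∫⁻ y, ENNReal.ofReal (rexp (-l * x)) * nn y x ∂(ν.restrict (Ioi 0)) := by
    intro x
    have hm : Measurable (fun y => nn y x) := nn_meas.comp (measurable_id.prodMk measurable_const)
    rw [lintegral_const_mul _ hm]
    simp only [Pi.mul_apply, kd]; ring
  have hl0 := lap_ell l hl
  unfold lap ell at hl0
  rw [lintegral_withDensity_eq_lintegral_mul _ one0_meas (by fun_prop)] at hl0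
  have hm : Measurable (fun p : ℝ × ℝ => ENNReal.ofReal (rexp (-l * p.1)) * nn p.2 p.1) :=
    (by fun_prop : Measurable (fun p : ℝ × ℝ => ENNReal.ofReal (rexp (-l * p.1)))).mul 
      (nn_meas.comp (measurable_snd.prodMk measurable_fst))
  have hbi : Integrable (fun y => (rexp (-l * y) - 1 + l * y)) (ν.restrict (Ioi 0)) := by
    refine ((integrable_min hνint).const_mul (l + l ^ 2)).mono' (by fun_prop) ?_
    refine (ae_restrict_iff' measurableSet_Ioi).2 (ae_of_all _ fun y hy => ?_)
    have hy : 0 < y := hy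
    have e : -l * y = -(l * y) := by ring
    rw [e, Real.norm_of_nonneg (phi_nonneg _)]
    exact (phi_le _ (by positivity)).trans (min_scale y l hy hl.le)
  have hnn : ∀ y, 0 ≤ rexp (-l * y) - 1 + l * y := by
    intro y
    have e : -l * y = -(l * y) := by ring
    rw [e]; exact phi_nonneg _
  have hI : 0 ≤ ∫ y in Set.Ioi (0 : ℝ), (rexp (-l * y) - 1 + l * y) ∂ν := integral_nonneg hnn
  rw [lintegral_congr h1, lintegral_add_left ((one0_meas.mul (by fun_prop)).const_mul _), 
    lintegral_const_mul _ (one0_meas.mul (by fun_prop)), hl0, lintegral_lintegral_swap hm.aemeasurable,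
    setLIntegral_congr_fun measurableSet_Ioi (fun y hy => lap_nn l y hl hy), 
    ← ofReal_integral_eq_lintegral_ofReal (hbi.div_const _) (ae_of_all _ fun y => div_nonneg (hnn y) (by positivity)),
    integral_div, ← ENNReal.ofReal_mul hb, ← ENNReal.ofReal_add (by positivity) (by positivity)]
  simp only [mul_zero, Real.exp_zero, ENNReal.ofReal_one, smul_eq_mul, mul_one]
  rw [← ENNReal.ofReal_add hc.le (by positivity)]
  congr 1
  unfold phi
  field_simp
  ring

end

section
open ProbabilityTheory

noncomputable def wm (w : ℝ → ℝ) : Measure ℝ := volume.withDensity (fun x => ENNReal.ofReal (w x))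

instance (w : ℝ → ℝ) : SFinite (wm w) := by unfold wm; infer_instance

lemma w_meas {w : ℝ → ℝ} (hneg : ∀ x < 0, w x = 0) (hcont : ContinuousOn w (Ici 0)) : Measurable w := by
  have : w = (Ici 0).indicator w := by
    ext x
    by_cases h : 0 ≤ x
    · simp [indicator, h]
    · simp [indicator, h, hneg x (not_le.1 h)]
  classical
  have h2 := ContinuousOn.measurable_piecewise (f := w) (g := fun _ => 0) hcont continuousOn_const measurableSet_Ici
  rw [this, ← piecewise_eq_indicator]
  exact h2

lemma phi_pos (b c : ℝ) (hb : 0 ≤ b) (ν : Measure ℝ) (l : ℝ) (hl : 0 < l) :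
    c * l ^ 2 ≤ phi b c ν l := by
  unfold phi
  have : 0 ≤ ∫ y in Set.Ioi (0 : ℝ), (rexp (-l * y) - 1 + l * y) ∂ν := integral_nonneg (by
    intro y
    have e : -l * y = -(l * y) := by ring
    simp only [e]; exact phi_nonneg _)
  have := mul_nonneg hb hl.le
  linarith

lemma scale_facts     (b c : ℝ) (hb : 0 ≤ b) (hc : 0 < c)
    (ν : Measure ℝ) 
    (hνint : ∫⁻ y in Set.Ioi (0 : ℝ), ENNReal.ofReal (min y (y ^ 2)) ∂ν ≠ ⊤)
    (W W' : ℝ → ℝ)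
    (hWnonneg : ∀ x : ℝ, 0 ≤ W x)
    (hWcont : ContinuousOn W (Set.Ici 0))
    (hWmono : StrictMonoOn W (Set.Ici 0))
    (hWlap : ∀ l : ℝ, 0 < l →
      (∫ x in Set.Ioi (0 : ℝ), Real.exp (-l * x) * W x) = 1 / phi b c ν l)
    (hW'neg : ∀ x : ℝ, x < 0 → W' x = 0)
    (hW'zero : W' 0 = 1 / c)
    (hW'deriv : ∀ x : ℝ, 0 < x → HasDerivAt W (W' x) x)
    (hW'cont : ContinuousOn W' (Set.Ici 0)) :
    (∀ x, 0 ≤ W' x) ∧ (kk b c (ν.restrict (Ioi 0))).conv (wm W') = ell ∧ ∀ x, W' x ≤ 1 / c := by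
  have hm := w_meas hW'neg hW'cont
  have hsf := sfinite_nu hνint
  have h0 : ∀ x, 0 ≤ W' x := by
    intro x
    rcases lt_trichotomy x 0 with h | h | h
    · rw [hW'neg x h]
    · rw [h, hW'zero]; positivity
    · have hd := (hW'deriv x h).hasDerivWithinAt (s := Ici 0)
      rw [← hd.derivWithin ((uniqueDiffOn_Ici 0) x h.le)]
      exact hWmono.monotoneOn.derivWithin_nonneg
  have hpp : ∀ l, 0 < l → 0 < phi b c ν l := fun l hl =>
    lt_of_lt_of_le (by positivity) (phi_pos b c hb ν l hl)
  have hWint : ∀ l, 0 < l → IntegrableOn (fun x => rexp (-l * x) * W x) (Ioi 0) := by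
    intro l hl
    by_contra hcon
    have := hWlap l hl
    rw [integral_undef hcon] at this
    have := hpp l hl
    have : 0 < 1 / phi b c ν l := by positivity
    linarith
  have hW0 : W 0 = 0 := by
    by_contra hne
    have hpos : 0 < W 0 := lt_of_le_of_ne (hWnonneg 0) (Ne.symm hne)
    have key : ∀ l, 0 < l → W 0 / l ≤ 1 / (c * l ^ 2) := by
      intro l hl
      have h1 : ∫ x in Ioi (0:ℝ), rexp (-l * x) * W 0 = W 0 / l := by
        rw [integral_mul_const, integral_exp_mul_Ioi (by linarith)]
        simp; field_simp
      rw [← h1]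
      calc _ ≤ ∫ x in Ioi (0:ℝ), rexp (-l * x) * W x := by
            refine setIntegral_mono_on ((integrableOn_exp_mul_Ioi (by linarith) 0).mul_const _) (hWint l hl) measurableSet_Ioi ?_
            intro x hx
            refine mul_le_mul_of_nonneg_left ?_ (Real.exp_pos _).le
            exact hWmono.monotoneOn self_mem_Ici (show (0:ℝ) ≤ x from le_of_lt hx) (le_of_lt hx)
        _ = 1 / phi b c ν l := hWlap l hl
        _ ≤ _ := one_div_le_one_div_of_le (by positivity) (phi_pos b c hb ν l hl)
    have h2 := key (2 / (c * W 0)) (by positivity)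
    field_simp at h2
    norm_num at h2
  have hWI : ∀ t, (wm W') (Iic t) = if 0 ≤ t then ENNReal.ofReal (W t) else 0 := by
    intro t
    unfold wm
    rw [withDensity_apply _ measurableSet_Iic]
    split_ifs with ht
    · have e1 : ∫⁻ x in Iic t, ENNReal.ofReal (W' x) = ∫⁻ x in Ioc 0 t, ENNReal.ofReal (W' x) := by
        rw [← lintegral_indicator measurableSet_Iic, ← lintegral_indicator measurableSet_Ioc]
        refine lintegral_congr_ae ?_
        have : ∀ᵐ x : ℝ, x ≠ 0 := by simp [ae_iff]
        filter_upwards [this] with x hx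
        rcases lt_or_gt_of_ne hx with h | h
        · simp [indicator, hW'neg x h]
        · simp [indicator, h]
      have hii : ContinuousOn W' (Icc 0 t) := hW'cont.mono Icc_subset_Ici_self
      rw [e1, ← ofReal_integral_eq_lintegral_ofReal
        ((hii.integrableOn_Icc).mono_set Ioc_subset_Icc_self) (ae_of_all _ h0), 
        ← intervalIntegral.integral_of_le ht,
        intervalIntegral.integral_eq_sub_of_hasDerivAt_of_le ht (hWcont.mono Icc_subset_Ici_self)
          (fun x hx => hW'deriv x hx.1) (hii.intervalIntegrable_of_Icc ht), hW0, sub_zero]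
    · rw [setLIntegral_congr_fun (g := fun _ => 0) measurableSet_Iic]
      · simp
      · intro x hx
        have hx : x ≤ t := hx
        simp [hW'neg x (by linarith)]
  have hlapW : ∀ l, 0 < l → lap (ell.conv (wm W')) l = ENNReal.ofReal (1 / phi b c ν l) := by
    intro l hl
    rw [ell_conv, lap, lintegral_withDensity_eq_lintegral_mul _ (meas_Iic _) (by fun_prop), ← hWlap l hl,
      ofReal_integral_eq_lintegral_ofReal (hWint l hl) (ae_of_all _ fun x => mul_nonneg (Real.exp_pos _).le (hWnonneg x)),
      ← lintegral_indicator measurableSet_Ioi]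
    refine lintegral_congr_ae ?_
    have : ∀ᵐ x : ℝ, x ≠ 0 := by simp [ae_iff]
    filter_upwards [this] with x hx
    simp only [Pi.mul_apply, hWI]
    rcases lt_or_gt_of_ne hx with h | h
    · simp [indicator, h.not_ge, h.not_gt]
    · simp only [h.le, if_true, indicator, mem_Ioi, h]
      rw [mul_comm, ENNReal.ofReal_mul (Real.exp_pos _).le]
  have hlapw : ∀ l, 0 < l → lap (wm W') l = ENNReal.ofReal (l / phi b c ν l) := by
    intro l hl
    have h1 := hlapW l hl
    rw [lap_conv, lap_ell l hl] at h1
    have h2 : ENNReal.ofReal l * (ENNReal.ofReal (1 / l) * lap (wm W') l) = 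
      ENNReal.ofReal l * ENNReal.ofReal (1 / phi b c ν l) := by rw [h1]
    rw [← mul_assoc, ← ENNReal.ofReal_mul hl.le, ← ENNReal.ofReal_mul hl.le] at h2
    rw [mul_one_div_cancel hl.ne'] at h2
    simpa [div_eq_mul_inv] using h2
  have hconv : (kk b c (ν.restrict (Ioi 0))).conv (wm W') = ell := by
    have hL : ∀ l, 0 < l → lap ((kk b c (ν.restrict (Ioi 0))).conv (wm W')) l = lap ell l := by
      intro l hl
      have := hpp l hl
      rw [lap_conv, lap_kk b c hb hc ν hνint l hl, hlapw l hl, lap_ell l hl, 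
        ← ENNReal.ofReal_mul (by positivity)]
      congr 1
      field_simp
    refine laplace_ext _ _ ?_ hL
    intro l hl
    have := hL l hl
    unfold lap at this
    rw [this]
    have := lap_ell l hl
    unfold lap at this
    rw [this]
    simp
  refine ⟨h0, hconv, ?_⟩
  -- upper bound
  have hle : ∀ᵐ x, ENNReal.ofReal c * ENNReal.ofReal (W' x) ≤ one0 x := by
    have h1 : ENNReal.ofReal c • wm W' ≤ ell := by
      rw [← hconv, kk, Measure.add_conv, Measure.conv_smul_left, Measure.dirac_zero_conv]
      exact Measure.le_add_right le_rfl
    unfold wm ell at h1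
    rw [← withDensity_smul _ (by fun_prop)] at h1
    refine ae_le_of_forall_setLIntegral_le_of_sigmaFinite (Measurable.const_mul (by fun_prop) _) ?_
    intro s hs _
    have := h1 s
    rwa [withDensity_apply _ hs, withDensity_apply _ hs] at this
  intro x
  by_cases hx : x < 0
  · rw [hW'neg x hx]; positivity
  push Not at hx
  obtain ⟨u, h1, h2, h3, h4⟩ := seq_right hle x
  have ht : Tendsto (fun n => W' (u n)) atTop (𝓝 (W' x)) := by
    refine Tendsto.comp (hW'cont x hx) ?_
    exact tendsto_nhdsWithin_iff.2 ⟨h4, Eventually.of_forall fun n => (hx.trans (h2 n).le)⟩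
  refine le_of_tendsto' ht fun n => ?_
  have := h3 n
  rw [← ENNReal.ofReal_mul hc.le] at this
  have h5 : ENNReal.ofReal (c * W' (u n)) ≤ 1 := this.trans (by unfold one0; exact indicator_le_self' (by simp) _)
  rw [ENNReal.ofReal_le_one] at h5
  rw [le_div_iff₀ hc]; linarith

end

section
open ProbabilityTheory

structure Ker (c : ℝ) (w : ℝ → ℝ) : Prop where
  hc : 0 < c
  neg : ∀ x < 0, w x = 0
  nonneg : ∀ x, 0 ≤ w x
  le : ∀ x, w x ≤ 1 / c
  cont : ContinuousOn w (Ici 0)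

lemma Ker.meas {c : ℝ} {w : ℝ → ℝ} (K : Ker c w) : Measurable w := w_meas K.neg K.cont

lemma Ker.right {c : ℝ} {w : ℝ → ℝ} (K : Ker c w) (x : ℝ) : ContinuousWithinAt w (Ici x) x := by
  by_cases h : x < 0
  · refine ContinuousAt.continuousWithinAt ?_
    refine (continuousAt_const (y := (0:ℝ))).congr ?_
    filter_upwards [Iio_mem_nhds h] with y hy
    exact (K.neg y hy).symm
  · push Not at h
    exact (K.cont x h).mono (Ici_subset_Ici.2 h)

lemma Ker.left {c : ℝ} {w : ℝ → ℝ} (K : Ker c w) (x : ℝ) : 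
    Tendsto w (𝓝[<] x) (𝓝 (if x ≤ 0 then 0 else w x)) := by
  split_ifs with h
  · refine tendsto_const_nhds.congr' ?_
    filter_upwards [self_mem_nhdsWithin] with y hy
    exact (K.neg y (lt_of_lt_of_le hy h)).symm
  · push Not at h
    exact ((K.cont.continuousAt (Ici_mem_nhds h)).tendsto).mono_left nhdsWithin_le_nhds

lemma Ker.cv_le {c : ℝ} {w : ℝ → ℝ} (K : Ker c w) (ρ : Measure ℝ) (t : ℝ) : 
    cv (fun x => ENNReal.ofReal (w x)) ρ t ≤ ENNReal.ofReal (1 / c) * ρ (Iic t) := by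
  unfold cv
  rw [← lintegral_indicator_const measurableSet_Iic]
  refine lintegral_mono fun s => ?_
  by_cases h : s ≤ t
  · simp only [indicator, mem_Iic, h, if_true]
    exact ENNReal.ofReal_le_ofReal (K.le _)
  · simp [K.neg (t - s) (by linarith)]

lemma Ker.cv_fin {c : ℝ} {w : ℝ → ℝ} (K : Ker c w) (ρ : Measure ℝ) (hρ : ∀ t, ρ (Iic t) ≠ ⊤) (t : ℝ) : 
    cv (fun x => ENNReal.ofReal (w x)) ρ t ≠ ⊤ :=
  ne_top_of_le_ne_top (ENNReal.mul_ne_top (by simp) (hρ t)) (K.cv_le ρ t)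

lemma Ker.cv_toReal {c : ℝ} {w : ℝ → ℝ} (K : Ker c w) (ρ : Measure ℝ) (t : ℝ) : 
    (cv (fun x => ENNReal.ofReal (w x)) ρ t).toReal = ∫ s, w (t - s) ∂ρ := by
  have hm : AEStronglyMeasurable (fun s => w (t - s)) ρ :=
    (K.meas.comp (measurable_const.sub measurable_id)).aestronglyMeasurable
  unfold cv
  rw [integral_eq_lintegral_of_nonneg_ae (ae_of_all _ fun s => K.nonneg _) hm]

lemma Ker.dct {c : ℝ} {w : ℝ → ℝ} (K : Ker c w) (ρ : Measure ℝ) (hρ : ∀ t, ρ (Iic t) ≠ ⊤) (t : ℝ) 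
    (F : Filter ℝ) [F.IsCountablyGenerated] (hF : F ≤ 𝓝 t) (g : ℝ → ℝ)
    (hg : ∀ s, Tendsto (fun r => w (r - s)) F (𝓝 (g s))) :
    Tendsto (fun r => ∫ s, w (r - s) ∂ρ) F (𝓝 (∫ s, g s ∂ρ)) := by
  have hwm := K.meas
  have := K.hc
  refine tendsto_integral_filter_of_dominated_convergence ((Iic (t + 1)).indicator (fun _ => 1 / c)) ?_ ?_ ?_ ?_
  · exact Eventually.of_forall fun r =>
      (hwm.comp (measurable_const.sub measurable_id)).aestronglyMeasurable
  · filter_upwards [hF (Iio_mem_nhds (show t < t + 1 by linarith))] with r hr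
    refine ae_of_all _ fun s => ?_
    rw [Real.norm_of_nonneg (K.nonneg _)]
    by_cases h : s ≤ t + 1
    · simp only [indicator, mem_Iic, h, if_true]; exact K.le _
    · have hr : r < t + 1 := hr
      rw [K.neg (r - s) (by linarith)]
      exact indicator_nonneg (fun _ _ => by positivity) _
  · rw [integrable_indicator_iff measurableSet_Iic]
    exact integrableOn_const (hρ _)
  · exact ae_of_all _ hg

lemma Ker.cadlag {c : ℝ} {w : ℝ → ℝ} (K : Ker c w) (ρ : Measure ℝ) (hρ : ∀ t, ρ (Iic t) ≠ ⊤) (t : ℝ) :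
    ContinuousWithinAt (fun r => ∫ s, w (r - s) ∂ρ) (Ici t) t ∧
    ∃ l, Tendsto (fun r => ∫ s, w (r - s) ∂ρ) (𝓝[<] t) (𝓝 l) := by
  constructor
  · refine K.dct ρ hρ t (𝓝[≥] t) nhdsWithin_le_nhds _ fun s => ?_
    refine Tendsto.comp (K.right (t - s)) ?_
    refine tendsto_nhdsWithin_iff.2 ⟨?_, ?_⟩
    · exact (Continuous.tendsto (by fun_prop) t).mono_left nhdsWithin_le_nhds
    · filter_upwards [self_mem_nhdsWithin] with r hr
      simp only [mem_Ici] at hr ⊢; linarith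
  · refine ⟨_, K.dct ρ hρ t (𝓝[<] t) nhdsWithin_le_nhds
      (fun s => if t - s ≤ 0 then 0 else w (t - s)) fun s => ?_⟩
    refine Tendsto.comp (K.left (t - s)) ?_
    refine tendsto_nhdsWithin_iff.2 ⟨?_, ?_⟩
    · exact (Continuous.tendsto (by fun_prop) t).mono_left nhdsWithin_le_nhds
    · filter_upwards [self_mem_nhdsWithin] with r hr
      simp only [mem_Iio] at hr ⊢; linarith

lemma Ker.wt_le {c : ℝ} {w : ℝ → ℝ} (K : Ker c w) (x : ℝ) : wm w (Iic x) ≤ ENNReal.ofReal (x / c) := by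
  have := K.hc
  unfold wm
  rw [withDensity_apply _ measurableSet_Iic, ← lintegral_indicator measurableSet_Iic]
  calc _ ≤ ∫⁻ r, (Icc 0 x).indicator (fun _ => ENNReal.ofReal (1 / c)) r := by
        refine lintegral_mono fun r => ?_
        by_cases h : r ≤ x
        · by_cases h0 : 0 ≤ r
          · simp only [indicator, mem_Iic, mem_Icc, h, h0, and_self, if_true]
            exact ENNReal.ofReal_le_ofReal (K.le _)
          · simp [indicator, K.neg r (not_le.1 h0)]
        · simp [indicator, h]
    _ = _ := by
        rw [lintegral_indicator_const measurableSet_Icc, Real.volume_Icc, ← ENNReal.ofReal_mul (by positivity)]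
        congr 1; ring

noncomputable def picard (w : ℝ → ℝ) (μ : Measure ℝ) : ℕ → ℝ → ℝ≥0∞
  | 0 => fun _ => 0
  | n + 1 => fun t => 1 + ∫⁻ s, wm w (Iic (t - s)) * picard w μ n s ∂μ

lemma picard_meas (w : ℝ → ℝ) (μ : Measure ℝ) [SFinite μ] (n : ℕ) : Measurable (picard w μ n) := by
  induction n with
  | zero => exact measurable_const
  | succ n ih =>
    have := meas_Iic (wm w)
    change Measurable (fun t => 1 + ∫⁻ s, wm w (Iic (t - s)) * picard w μ n s ∂μ)
    refine Measurable.const_add ?_ _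
    refine Measurable.lintegral_prod_right' (f := fun p : ℝ × ℝ => wm w (Iic (p.1 - p.2)) * picard w μ n p.2) ?_
    exact (this.comp (measurable_fst.sub measurable_snd)).mul (ih.comp measurable_snd)

lemma picard_mono (w : ℝ → ℝ) (μ : Measure ℝ) : Monotone (picard w μ) := by
  refine monotone_nat_of_le_succ fun n => ?_
  induction n with
  | zero => intro t; simp [picard]
  | succ n ih =>
    intro t
    change 1 + ∫⁻ s, wm w (Iic (t - s)) * picard w μ n s ∂μ ≤
      1 + ∫⁻ s, wm w (Iic (t - s)) * picard w μ (n + 1) s ∂μ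
    gcongr with s
    exact ih s

noncomputable def EE (w : ℝ → ℝ) (μ : Measure ℝ) (t : ℝ) : ℝ≥0∞ := ⨆ n, picard w μ n t

lemma EE_meas (w : ℝ → ℝ) (μ : Measure ℝ) [SFinite μ] : Measurable (EE w μ) := by
  unfold EE
  exact Measurable.iSup fun n => picard_meas w μ n

lemma EE_eq (w : ℝ → ℝ) (μ : Measure ℝ) [SFinite μ] (t : ℝ) :
    EE w μ t = 1 + ∫⁻ s, wm w (Iic (t - s)) * EE w μ s ∂μ := by
  have h1 : ∫⁻ s, wm w (Iic (t - s)) * EE w μ s ∂μ = ⨆ n, ∫⁻ s, wm w (Iic (t - s)) * picard w μ n s ∂μ := by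
    unfold EE
    simp_rw [ENNReal.mul_iSup]
    refine lintegral_iSup (fun n => ?_) ?_
    · exact ((meas_Iic (wm w)).comp (measurable_const.sub measurable_id)).mul (picard_meas w μ n)
    · intro m n hmn s
      exact mul_le_mul_right (picard_mono w μ hmn s) _
  rw [h1, ENNReal.add_iSup]
  unfold EE
  rw [← (show Monotone (fun n => picard w μ n t) from fun m n h => picard_mono w μ h t).iSup_nat_add 1]
  rfl

lemma picard_le {c : ℝ} {w : ℝ → ℝ} (K : Ker c w) (μ : Measure ℝ) (hμ0 : μ (Iio 0) = 0)
    (T l : ℝ) (hl : 0 < l) (hM : 2 * μ (Iic T) ≤ ENNReal.ofReal (c * l)) (n : ℕ) :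
    ∀ t, 0 ≤ t → t ≤ T → picard w μ n t ≤ ENNReal.ofReal (2 * rexp (l * t)) := by
  have hc := K.hc
  induction n with
  | zero => intro t _ _; simp [picard]
  | succ n ih =>
    intro t ht hT
    rw [picard]
    have h1 : ∫⁻ s, wm w (Iic (t - s)) * picard w μ n s ∂μ ≤ ENNReal.ofReal (rexp (l * t)) := by
      calc _ ≤ ∫⁻ s, (Iic T).indicator (fun _ => ENNReal.ofReal (2 * rexp (l * t) / (c * l))) s ∂μ := by
            refine lintegral_mono_ae ?_
            have : ∀ᵐ s ∂μ, 0 ≤ s := by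
              rw [ae_iff]; simpa [Iio] using hμ0
            filter_upwards [this] with s hs
            by_cases h : s ≤ t
            · have hsT : s ≤ T := h.trans hT
              simp only [indicator, mem_Iic, hsT, if_true]
              calc _ ≤ ENNReal.ofReal ((t - s) / c) * ENNReal.ofReal (2 * rexp (l * s)) :=
                    mul_le_mul' (K.wt_le _) (ih s hs hsT)
                _ = ENNReal.ofReal ((t - s) / c * (2 * rexp (l * s))) := by
                    rw [ENNReal.ofReal_mul (div_nonneg (by linarith) hc.le)]
                _ ≤ _ := by
                    refine ENNReal.ofReal_le_ofReal ?_
                    have e1 : rexp (l * t) = rexp (l * (t - s)) * rexp (l * s) := by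
                      rw [← Real.exp_add]; congr 1; ring
                    have e2 : l * (t - s) ≤ rexp (l * (t - s)) := by
                      linarith [Real.add_one_le_exp (l * (t - s))]
                    rw [e1, le_div_iff₀ (by positivity)]
                    have := mul_le_mul_of_nonneg_right e2 (Real.exp_pos (l * s)).le
                    calc _ = 2 * (l * (t - s) * rexp (l * s)) := by field_simp
                      _ ≤ _ := by linarith
            · have : wm w (Iic (t - s)) = 0 := by
                have := K.wt_le (t - s)
                rw [ENNReal.ofReal_of_nonpos (div_nonpos_of_nonpos_of_nonneg (by linarith) hc.le)] at this
                exact le_antisymm this bot_le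
              simp [this]
        _ = ENNReal.ofReal (rexp (l * t) / (c * l)) * (2 * μ (Iic T)) := by
            rw [lintegral_indicator_const measurableSet_Iic, ← mul_assoc]
            congr 1
            rw [mul_div_assoc, mul_comm 2, ENNReal.ofReal_mul (by positivity)]
            simp
        _ ≤ ENNReal.ofReal (rexp (l * t) / (c * l)) * ENNReal.ofReal (c * l) := by gcongr
        _ = _ := by
            rw [← ENNReal.ofReal_mul (by positivity)]
            congr 1; field_simp
    calc 1 + _ ≤ ENNReal.ofReal (rexp (l * t)) + ENNReal.ofReal (rexp (l * t)) := by
          refine add_le_add ?_ h1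
          rw [ENNReal.one_le_ofReal]
          exact Real.one_le_exp (by positivity)
      _ = _ := by
          rw [← ENNReal.ofReal_add (by positivity) (by positivity)]; congr 1; ring

lemma EE_mono (w : ℝ → ℝ) (μ : Measure ℝ) [SFinite μ] : Monotone (EE w μ) := by
  intro a b hab
  rw [EE_eq, EE_eq w μ b]
  gcongr

lemma EE_fin {c : ℝ} {w : ℝ → ℝ} (K : Ker c w) (μ : Measure ℝ) [SFinite μ] (hμ0 : μ (Iio 0) = 0)
    (hμ : ∀ t, μ (Iic t) ≠ ⊤) (t : ℝ) : EE w μ t ≠ ⊤ := by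
  refine ne_top_of_le_ne_top ?_ (EE_mono w μ (le_max_left t 0))
  set T := max t 0
  have hc := K.hc
  set l := 2 * (μ (Iic T)).toReal / c + 1 with hl
  have hl0 : 0 < l := by positivity
  refine ne_top_of_le_ne_top (b := ENNReal.ofReal (2 * rexp (l * T))) ENNReal.ofReal_ne_top ?_
  refine iSup_le fun n => picard_le K μ hμ0 T l hl0 ?_ n T (le_max_right _ _) le_rfl
  rw [← ENNReal.ofReal_toReal (hμ T)]
  rw [show (2:ℝ≥0∞) = ENNReal.ofReal 2 by simp, ← ENNReal.ofReal_mul (by norm_num)]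
  refine ENNReal.ofReal_le_ofReal ?_
  rw [hl]
  field_simp
  linarith

lemma EE_nonpos {c : ℝ} {w : ℝ → ℝ} (K : Ker c w) (μ : Measure ℝ) [SFinite μ] (hμ0 : μ (Iio 0) = 0)
    (t : ℝ) (ht : t ≤ 0) : EE w μ t = 1 := by
  rw [EE_eq, lintegral_congr_ae (g := fun _ => 0)]
  · simp
  · have : ∀ᵐ s ∂μ, 0 ≤ s := by
      rw [ae_iff]; simpa [Iio] using hμ0
    filter_upwards [this] with s hs
    have := K.wt_le (t - s)
    rw [ENNReal.ofReal_of_nonpos (div_nonpos_of_nonpos_of_nonneg (by linarith) K.hc.le)] at this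
    rw [le_antisymm this bot_le, zero_mul]

lemma conv_Iic (α ρ : Measure ℝ) [SFinite α] [SFinite ρ] (t : ℝ) :
    (α.conv ρ) (Iic t) = ∫⁻ s, α (Iic (t - s)) ∂ρ := by
  rw [Measure.conv_comm, ← lintegral_indicator_one measurableSet_Iic, 
    Measure.lintegral_conv (measurable_one.indicator measurableSet_Iic)]
  refine lintegral_congr fun s => ?_
  rw [← lintegral_indicator_one measurableSet_Iic]
  refine lintegral_congr fun x => ?_
  have : s + x ≤ t ↔ x ≤ t - s := by constructor <;> intro h <;> linarith
  simp [indicator, this]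

/-- The density `Z`. -/
noncomputable def ZZ (w : ℝ → ℝ) (μ : Measure ℝ) : ℝ → ℝ≥0∞ := 
  cv (fun x => ENNReal.ofReal (w x)) (μ.withDensity (EE w μ))

lemma EE_Z {c : ℝ} {w : ℝ → ℝ} (K : Ker c w) (μ : Measure ℝ) [SFinite μ] (t : ℝ) : 
    EE w μ t = 1 + ∫⁻ s in Iic t, ZZ w μ s := by
  have hm := K.meas
  rw [EE_eq, ← withDensity_apply _ measurableSet_Iic, ZZ, ← conv_dens (by fun_prop)]
  change _ = 1 + ((wm w).conv _) _
  rw [conv_Iic, lintegral_withDensity_eq_lintegral_mul _ (EE_meas w μ)]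
  · congr 1
    refine lintegral_congr fun s => ?_
    simp [mul_comm]
  · exact (meas_Iic (wm w)).comp (measurable_const.sub measurable_id)

lemma rho_fin {c : ℝ} {w : ℝ → ℝ} (K : Ker c w) (μ : Measure ℝ) [SFinite μ] (hμ0 : μ (Iio 0) = 0)
    (hμ : ∀ t, μ (Iic t) ≠ ⊤) (t : ℝ) : (μ.withDensity (EE w μ)) (Iic t) ≠ ⊤ := by
  rw [withDensity_apply _ measurableSet_Iic]
  refine ne_top_of_le_ne_top (ENNReal.mul_ne_top (EE_fin K μ hμ0 hμ t) (hμ t)) ?_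
  rw [← setLIntegral_const]
  exact setLIntegral_mono measurable_const (fun s hs => EE_mono w μ hs)

end

section
open ProbabilityTheory

structure Prim (g G : ℝ → ℝ) : Prop where
  neg : ∀ t < 0, g t = 0
  nn : ∀ t, 0 ≤ g t
  meas : Measurable g
  right : ∀ t, ContinuousWithinAt g (Ici t) t
  int : ∀ a b, IntervalIntegrable g volume a b
  eq : ∀ t, G t = ∫ s in (0:ℝ)..t, g s

lemma right_deriv {g : ℝ → ℝ} (hm : Measurable g) (hi : ∀ a b, IntervalIntegrable g volume a b) (a t : ℝ)
    (hr : ContinuousWithinAt g (Ici t) t) : 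
    HasDerivWithinAt (fun u => ∫ s in a..u, g s) (g t) (Ici t) t := 
  intervalIntegral.integral_hasDerivWithinAt_right (hi a t) (t := Ioi t)
    (hm.stronglyMeasurable.stronglyMeasurableAtFilter) (hr.mono Ioi_subset_Ici_self)

namespace Prim
variable {g G : ℝ → ℝ}

lemma deriv (P : Prim g G) (t : ℝ) : HasDerivWithinAt G (g t) (Ici t) t := by
  have : G = fun u => ∫ s in (0:ℝ)..u, g s := funext P.eq
  rw [this]
  exact right_deriv P.meas P.int 0 t (P.right t)

lemma cont (P : Prim g G) : Continuous G := by
  have : G = fun u => ∫ s in (0:ℝ)..u, g s := funext P.eq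
  rw [this]
  exact intervalIntegral.continuous_primitive P.int 0

lemma nonpos (P : Prim g G) (t : ℝ) (ht : t ≤ 0) : G t = 0 := by
  rw [P.eq, intervalIntegral.integral_symm, intervalIntegral.integral_of_le ht, 
    setIntegral_congr_set Ioo_ae_eq_Ioc.symm,
    setIntegral_eq_zero_of_forall_eq_zero (fun s hs => P.neg s hs.2)]
  simp

lemma nonneg (P : Prim g G) (t : ℝ) : 0 ≤ G t := by
  rcases le_total t 0 with h | h
  · rw [P.nonpos t h]
  · rw [P.eq]
    exact intervalIntegral.integral_nonneg h (fun s _ => P.nn s)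

lemma sub_eq (P : Prim g G) (a b : ℝ) : ∫ s in a..b, g s = G b - G a := by
  rw [P.eq, P.eq, intervalIntegral.integral_interval_sub_left (P.int _ _) (P.int _ _)]

end Prim

lemma lint_Iic {f : ℝ → ℝ} (h0 : ∀ t < 0, f t = 0) (hn : ∀ t, 0 ≤ f t) 
    (hi : ∀ a b, IntervalIntegrable f volume a b) (t : ℝ) :
    ∫⁻ s in Iic t, ENNReal.ofReal (f s) = ENNReal.ofReal (∫ s in (0:ℝ)..t, f s) := by
  rcases lt_or_ge t 0 with h | h
  · rw [setLIntegral_congr_fun (g := fun _ => 0) measurableSet_Iic]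
    · rw [intervalIntegral.integral_symm, intervalIntegral.integral_of_le h.le, 
        setIntegral_congr_set Ioo_ae_eq_Ioc.symm,
        setIntegral_eq_zero_of_forall_eq_zero (fun s hs => h0 s hs.2)]
      simp
    · intro s hs
      have hs : s ≤ t := hs
      simp [h0 s (by linarith)]
  · rw [intervalIntegral.integral_of_le h, ofReal_integral_eq_lintegral_ofReal (hi 0 t).1 (ae_of_all _ hn), 
      ← lintegral_indicator measurableSet_Iic, ← lintegral_indicator measurableSet_Ioc]
    refine lintegral_congr_ae ?_
    have : ∀ᵐ x : ℝ, x ≠ 0 := by simp [ae_iff]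
    filter_upwards [this] with x hx
    rcases lt_or_gt_of_ne hx with h | h
    · simp [indicator, h0 x h]
    · simp [indicator, h]

/-- `N_y`. -/
noncomputable def NN (G : ℝ → ℝ) (y t : ℝ) : ℝ := y * G t - ∫ r in (t - y)..t, G r

namespace Prim
variable {g G : ℝ → ℝ}

lemma NN_eq (P : Prim g G) (y t : ℝ) (hy : 0 < y) : NN G y t = ∫ s in (t - y)..t, (y - (t - s)) * g s := by
  have h1 : ∫ s in (t - y)..t, (G s + (y - (t - s)) * g s) = y * G t := by
    rw [intervalIntegral.integral_eq_sub_of_hasDeriv_right (f := fun s => (y - (t - s)) * G s)]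
    · simp
    · have := P.cont
      exact Continuous.continuousOn (by fun_prop)
    · intro s _
      have a1 : HasDerivWithinAt (fun s => y - (t - s)) (-(-1)) (Ioi s) s :=
        (((hasDerivAt_id s).const_sub t).const_sub y).hasDerivWithinAt
      refine (a1.mul (P.deriv s).Ioi_of_Ici).congr_deriv ?_
      ring
    · exact (P.cont.intervalIntegrable _ _).add ((P.int _ _).continuousOn_mul (by fun_prop))
  rw [intervalIntegral.integral_add (P.cont.intervalIntegrable _ _) ((P.int _ _).continuousOn_mul (by fun_prop))] at h1
  unfold NN
  linarith

lemma NN_nonneg (P : Prim g G) (y t : ℝ) (hy : 0 < y) : 0 ≤ NN G y t := by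
  rw [P.NN_eq y t hy]
  refine intervalIntegral.integral_nonneg (by linarith) fun s hs => ?_
  exact mul_nonneg (by linarith [hs.1]) (P.nn s)

lemma NN_nonpos (P : Prim g G) (y t : ℝ) (hy : 0 < y) (ht : t ≤ 0) : NN G y t = 0 := by
  unfold NN
  rw [P.nonpos t ht, intervalIntegral.integral_congr (g := fun _ => 0)]
  · simp
  · intro s hs
    rw [uIcc_of_le (by linarith)] at hs
    exact P.nonpos s (hs.2.trans ht)

lemma NN_cont (P : Prim g G) : Continuous (fun p : ℝ × ℝ => NN G p.1 p.2) := by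
  unfold NN
  have hc := P.cont
  have h : ∀ p : ℝ × ℝ, ∫ r in (p.2 - p.1)..p.2, G r = 
    (∫ r in (0:ℝ)..p.2, G r) - ∫ r in (0:ℝ)..(p.2 - p.1), G r := by
    intro p
    rw [intervalIntegral.integral_interval_sub_left (hc.intervalIntegrable _ _) (hc.intervalIntegrable _ _)]
  simp_rw [h]
  have h2 : Continuous (fun u => ∫ r in (0:ℝ)..u, G r) := 
    intervalIntegral.continuous_primitive (fun a b => hc.intervalIntegrable a b) 0
  fun_prop

lemma cv_nn (P : Prim g G) (y t : ℝ) (hy : 0 < y) : 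
    cv (_root_.nn y) (volume.withDensity (fun s => ENNReal.ofReal (g s))) t = ENNReal.ofReal (NN G y t) := by
  have hm := P.meas
  have hnm : Measurable (fun s => _root_.nn y (t - s)) := 
    nn_meas.comp (measurable_const.prodMk (measurable_const.sub measurable_id))
  unfold cv
  rw [lintegral_withDensity_eq_lintegral_mul _ (by fun_prop) hnm, P.NN_eq y t hy, 
    intervalIntegral.integral_of_le (by linarith), ofReal_integral_eq_lintegral_ofReal
      ((P.int _ _).continuousOn_mul (f := g) (by fun_prop)).1, ← lintegral_indicator measurableSet_Ioc]
  · refine lintegral_congr fun s => ?_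
    simp only [Pi.mul_apply, _root_.nn, one0, indicator, mem_Ici, sub_nonneg, mem_Ioc]
    by_cases h1 : s ≤ t
    · by_cases h2 : t - y < s
      · simp only [h1, h2, and_self, if_true]
        rw [ENNReal.ofReal_mul (by linarith)]
        simp [mul_comm]
      · have : ENNReal.ofReal (y - (t - s)) = 0 := ENNReal.ofReal_of_nonpos (by linarith)
        simp [h2, this]
    · simp [h1]
  · refine (ae_restrict_iff' measurableSet_Ioc).2 (ae_of_all _ fun s hs => ?_)
    exact mul_nonneg (by linarith [hs.1]) (P.nn s)

/-- log transform -/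
lemma e_pos (P : Prim g G) (t : ℝ) : 0 < 1 + G t := by linarith [P.nonneg t]

lemma log_prim (P : Prim g G) : Prim (fun t => g t / (1 + G t)) (fun t => Real.log (1 + G t)) := by
  have hc := P.cont
  have hne : ∀ t, 1 + G t ≠ 0 := fun t => (P.e_pos t).ne'
  have hint : ∀ a b, IntervalIntegrable (fun t => g t / (1 + G t)) volume a b := by
    intro a b
    simp_rw [div_eq_mul_inv]
    exact (P.int a b).mul_continuousOn (Continuous.continuousOn (by fun_prop (disch := exact hne)))
  refine ⟨?_, ?_, ?_, ?_, hint, ?_⟩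
  · intro t ht; simp [P.neg t ht]
  · intro t; exact div_nonneg (P.nn t) (P.e_pos t).le
  · exact P.meas.div (by fun_prop)
  · intro t
    exact (P.right t).div (Continuous.continuousWithinAt (by fun_prop)) (hne t)
  · intro t
    rw [intervalIntegral.integral_eq_sub_of_hasDeriv_right (f := fun s => Real.log (1 + G s)) _ _ (hint _ _)]
    · rw [P.nonpos 0 le_rfl]; simp
    · exact Continuous.continuousOn (by fun_prop (disch := exact hne))
    · intro s _
      exact ((P.deriv s).Ioi_of_Ici.const_add 1).log (hne s)

lemma inv_int (P : Prim g G) (a b : ℝ) : 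
    IntervalIntegrable (fun s => g s / (1 + G s) / (1 + G s)) volume a b := by
  have hc := P.cont
  have hne : ∀ t, 1 + G t ≠ 0 := fun t => (P.e_pos t).ne'
  have := ((P.log_prim).int a b).mul_continuousOn (g := fun s => (1 + G s)⁻¹) (Continuous.continuousOn (by fun_prop (disch := exact hne)))
  simpa only [div_eq_mul_inv] using this

lemma inv_eq (P : Prim g G) (a b : ℝ) : 
    ∫ s in a..b, g s / (1 + G s) / (1 + G s) = 1 / (1 + G a) - 1 / (1 + G b) := by
  have hc := P.cont
  have hne : ∀ t, 1 + G t ≠ 0 := fun t => (P.e_pos t).ne'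
  rw [intervalIntegral.integral_eq_sub_of_hasDeriv_right (f := fun s => - (1 + G s)⁻¹) _ _ (P.inv_int a b)]
  · simp; ring
  · exact Continuous.continuousOn (by fun_prop (disch := exact hne))
  · intro s _
    refine (((P.deriv s).Ioi_of_Ici.const_add 1).inv (hne s)).neg.congr_deriv ?_
    have := hne s
    field_simp

lemma b_ident (P : Prim g G) (t : ℝ) :
    ENNReal.ofReal (G t / (1 + G t)) + ∫⁻ s in Iic t, ENNReal.ofReal (G s * (g s / (1 + G s) / (1 + G s)))
     = ENNReal.ofReal (Real.log (1 + G t)) := by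
  have hc := P.cont
  have hne : ∀ t, 1 + G t ≠ 0 := fun t => (P.e_pos t).ne'
  have hii : ∀ a b, IntervalIntegrable (fun s => G s * (g s / (1 + G s) / (1 + G s))) volume a b :=
    fun a b => (P.inv_int a b).continuousOn_mul hc.continuousOn
  have hnn : ∀ s, 0 ≤ G s * (g s / (1 + G s) / (1 + G s)) := fun s => 
    mul_nonneg (P.nonneg s) (div_nonneg (div_nonneg (P.nn s) (P.e_pos s).le) (P.e_pos s).le)
  rw [lint_Iic _ hnn hii]
  swap
  · intro t ht; simp [P.neg t ht]
  rcases le_total t 0 with ht | ht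
  · rw [P.nonpos t ht, intervalIntegral.integral_congr (g := fun _ => 0)]
    · simp
    · intro s hs
      rw [uIcc_of_ge ht] at hs
      simp [P.nonpos s hs.2]
  rw [← ENNReal.ofReal_add (div_nonneg (P.nonneg t) (P.e_pos t).le) (intervalIntegral.integral_nonneg ht fun s _ => hnn s)]
  congr 1
  have h1 : (fun s => G s * (g s / (1 + G s) / (1 + G s))) = 
      fun s => g s / (1 + G s) - g s / (1 + G s) / (1 + G s) := by
    ext s
    have := hne s
    field_simp
    ring
  rw [h1, intervalIntegral.integral_sub (P.log_prim.int _ _) (P.inv_int _ _), P.inv_eq, P.log_prim.sub_eq, 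
    P.nonpos 0 le_rfl]
  have := hne t
  simp
  field_simp
  ring

lemma y_ident_real (P : Prim g G) (y t : ℝ) (hy : 0 < y) (ht : 0 ≤ t) :
    NN G y t / (1 + G t) + ∫ s in (0:ℝ)..t, NN G y s * (g s / (1 + G s) / (1 + G s)) =
    NN (fun t => Real.log (1 + G t)) y t + 
    ∫ s in (0:ℝ)..t, (rexp (-(Real.log (1 + G s) - Real.log (1 + G (s - y)))) - 1 
      + (Real.log (1 + G s) - Real.log (1 + G (s - y)))) := by
  have hc := P.cont
  have hne : ∀ t, 1 + G t ≠ 0 := fun t => (P.e_pos t).ne'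
  have hNc : Continuous (NN G y) := P.NN_cont.comp (by fun_prop : Continuous fun t : ℝ => (y, t))
  set I := fun t => Real.log (1 + G t) with hI
  have hIc : Continuous I := P.log_prim.cont
  have hNIc : Continuous (NN I y) := P.log_prim.NN_cont.comp (by fun_prop : Continuous fun t : ℝ => (y, t))
  have hii : ∀ a b, IntervalIntegrable (fun s => NN G y s * (g s / (1 + G s) / (1 + G s))) volume a b :=
    fun a b => (P.inv_int a b).continuousOn_mul hNc.continuousOn
  set φ := fun s => rexp (-(I s - I (s - y))) - 1 + (I s - I (s - y)) with hφ
  have hφc : Continuous φ := by fun_prop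
  have hNd : ∀ {h H : ℝ → ℝ} (_ : Prim h H) (x : ℝ), HasDerivWithinAt (NN H y) (y * h x - (H x - H (x - y))) (Ici x) x := by
    intro h H Q x
    have hHc := Q.cont
    have e1 : NN H y = fun t => y * H t - ((∫ r in (0:ℝ)..t, H r) - ∫ r in (0:ℝ)..(t - y), H r) := by
      ext t
      unfold NN
      rw [intervalIntegral.integral_interval_sub_left (hHc.intervalIntegrable _ _) (hHc.intervalIntegrable _ _)]
    rw [e1]
    have d1 : HasDerivAt (fun t => ∫ r in (0:ℝ)..t, H r) (H x) x := 
      intervalIntegral.integral_hasDerivAt_right (hHc.intervalIntegrable _ _) (hHc.stronglyMeasurableAtFilter _ _) hHc.continuousAt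
    have d2 : HasDerivAt (fun t => ∫ r in (0:ℝ)..t, H r) (H (x - y)) (x - y) := 
      intervalIntegral.integral_hasDerivAt_right (hHc.intervalIntegrable _ _) (hHc.stronglyMeasurableAtFilter _ _) hHc.continuousAt
    have d3 := HasDerivAt.comp_sub_const x y d2
    exact ((Q.deriv x).const_mul y).sub (d1.sub d3).hasDerivWithinAt
  have key := constant_of_has_deriv_right_zero (a := 0) (b := t) 
    (f := fun t => (NN G y t / (1 + G t) + ∫ s in (0:ℝ)..t, NN G y s * (g s / (1 + G s) / (1 + G s))) - 
      (NN I y t + ∫ s in (0:ℝ)..t, φ s)) ?_ ?_ t ⟨ht, le_rfl⟩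
  · have hN0 : NN G y 0 = NN I y 0 := by
      unfold NN
      have : ∀ x, x ≤ 0 → I x = 0 := P.log_prim.nonpos
      rw [this 0 le_rfl, P.nonpos 0 le_rfl]
      rw [intervalIntegral.integral_congr (g := I)]
      intro s hs
      rw [uIcc_of_le (by linarith)] at hs
      simp only [this s hs.2, P.nonpos s hs.2]
    simp only [intervalIntegral.integral_same, P.nonpos 0 le_rfl, hN0] at key
    simp only [add_zero, div_one, sub_self] at key
    linarith
  · refine Continuous.continuousOn ?_
    have c1 := intervalIntegral.continuous_primitive hii 0
    have c2 := intervalIntegral.continuous_primitive (fun a b => hφc.intervalIntegrable (μ := volume) a b) 0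
    fun_prop (disch := exact hne)
  · intro x _
    have d1 := (hNd P x).div ((P.deriv x).const_add 1) (hne x)
    have d2 := right_deriv (g := fun s => NN G y s * (g s / (1 + G s) / (1 + G s)))
      (hNc.measurable.mul ((P.meas.div (by fun_prop)).div (by fun_prop))) hii 0 x
      (hNc.continuousWithinAt.mul (((P.right x).div (by fun_prop) (hne x)).div (by fun_prop) (hne x)))
    have d3 := hNd P.log_prim x
    have d4 := right_deriv hφc.measurable (fun a b => hφc.intervalIntegrable a b) 0 x hφc.continuousWithinAt
    refine ((d1.add d2).sub (d3.add d4)).congr_deriv ?_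
    have e1 : rexp (-(I x - I (x - y))) = (1 + G (x - y)) / (1 + G x) := by
      rw [neg_sub, Real.exp_sub, hI]
      simp only
      rw [Real.exp_log (P.e_pos _), Real.exp_log (P.e_pos _)]
    simp only [hφ, e1]
    have := hne x
    simp only [hI]
    field_simp
    ring

lemma y_ident (P : Prim g G) (y t : ℝ) (hy : 0 < y) :
    ENNReal.ofReal (NN G y t / (1 + G t)) + 
      ∫⁻ s in Iic t, ENNReal.ofReal (NN G y s * (g s / (1 + G s) / (1 + G s))) =
    ENNReal.ofReal (NN (fun t => Real.log (1 + G t)) y t) + 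
    ∫⁻ s in Iic t, ENNReal.ofReal (rexp (-(Real.log (1 + G s) - Real.log (1 + G (s - y)))) - 1 
      + (Real.log (1 + G s) - Real.log (1 + G (s - y)))) := by
  have hc := P.cont
  have hne : ∀ t, 1 + G t ≠ 0 := fun t => (P.e_pos t).ne'
  have hNc : Continuous (NN G y) := P.NN_cont.comp (by fun_prop : Continuous fun t : ℝ => (y, t))
  have hI : Continuous (fun t => Real.log (1 + G t)) := P.log_prim.cont
  have hI2 : Continuous (fun t => Real.log (1 + G (t - y))) := hI.comp (by fun_prop : Continuous fun t : ℝ => t - y)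
  have hI0 : ∀ t ≤ 0, Real.log (1 + G t) = 0 := P.log_prim.nonpos
  have n1 : ∀ s, 0 ≤ NN G y s * (g s / (1 + G s) / (1 + G s)) := fun s => 
    mul_nonneg (P.NN_nonneg y s hy) (div_nonneg (div_nonneg (P.nn s) (P.e_pos s).le) (P.e_pos s).le)
  rcases lt_or_ge t 0 with ht | ht
  · rw [P.NN_nonpos y t hy ht.le, P.log_prim.NN_nonpos y t hy ht.le]
    congr 1
    · simp
    · refine setLIntegral_congr_fun measurableSet_Iic fun s hs => ?_
      have hs : s ≤ t := hs
      simp [P.NN_nonpos y s hy (by linarith), hI0 s (by linarith), hI0 (s - y) (by linarith)]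
  · rw [lint_Iic _ n1, lint_Iic, ← ENNReal.ofReal_add, ← ENNReal.ofReal_add, P.y_ident_real y t hy ht]
    · exact P.log_prim.NN_nonneg y t hy
    · exact intervalIntegral.integral_nonneg ht fun s _ => phi_nonneg _
    · exact div_nonneg (P.NN_nonneg y t hy) (P.e_pos t).le
    · exact intervalIntegral.integral_nonneg ht fun s _ => n1 s
    · intro s hs
      simp [hI0 s (by linarith), hI0 (s - y) (by linarith)]
    · intro s; exact phi_nonneg _
    · intro a b
      exact Continuous.intervalIntegrable (by fun_prop) _ _
    · intro a b; exact (P.inv_int a b).continuousOn_mul hNc.continuousOn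
    · intro s hs; simp [P.neg s hs]

end Prim

end

section

lemma Prim.wm_Iic {g G : ℝ → ℝ} (P : Prim g G) (t : ℝ) : wm g (Iic t) = ENNReal.ofReal (G t) := by
  unfold wm
  rw [withDensity_apply _ measurableSet_Iic, lint_Iic P.neg P.nn P.int, P.eq]

/-- density of `k * g` -/
noncomputable def kg (b c : ℝ) (n : Measure ℝ) (g G : ℝ → ℝ) (t : ℝ) : ℝ≥0∞ :=
  ENNReal.ofReal c * ENNReal.ofReal (g t) + (ENNReal.ofReal b * ENNReal.ofReal (G t) + 
    ∫⁻ y, ENNReal.ofReal (NN G y t) ∂n)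

lemma kg_meas (b c : ℝ) (n : Measure ℝ) [SFinite n] {g G : ℝ → ℝ} (P : Prim g G) : 
    Measurable (kg b c n g G) := by
  unfold kg
  have := P.meas
  have h2 := P.cont.measurable
  have h3 := P.NN_cont.measurable
  have h4 : Measurable fun t => ∫⁻ y, ENNReal.ofReal (NN G y t) ∂n :=
    Measurable.lintegral_prod_left' (f := fun p : ℝ × ℝ => ENNReal.ofReal (NN G p.1 p.2)) (by fun_prop)
  fun_prop

lemma kk_conv (b c : ℝ) (n : Measure ℝ) [SFinite n] (hn : ∀ᵐ y ∂n, 0 < y) {g G : ℝ → ℝ} (P : Prim g G) :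
    (kk b c n).conv (wm g) = volume.withDensity (kg b c n g G) := by
  have hm := P.meas
  have h1 : cv (kd b n) (wm g) = fun t => ENNReal.ofReal b * ENNReal.ofReal (G t) + 
    ∫⁻ y, ENNReal.ofReal (NN G y t) ∂n := by
    ext t
    unfold cv kd
    have m1 : Measurable fun s => one0 (t - s) := one0_meas.comp (by fun_prop)
    rw [lintegral_add_left (m1.const_mul _), lintegral_const_mul _ m1]
    congr 1
    · rw [← P.wm_Iic, ← cv_one0]; rfl
    · rw [lintegral_lintegral_swap]
      · refine lintegral_congr_ae ?_
        filter_upwards [hn] with y hy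
        exact P.cv_nn y t hy
      · exact (nn_meas.comp (by fun_prop : Measurable fun p : ℝ × ℝ => (p.2, t - p.1))).aemeasurable
  unfold kk
  rw [Measure.add_conv, Measure.conv_smul_left, Measure.dirac_zero_conv, conv_dens (kd_meas b n), h1]
  unfold wm
  rw [← withDensity_smul _ (by fun_prop), ← withDensity_add_left (by fun_prop)]
  rfl

lemma parts {z G : ℝ → ℝ} (P : Prim z G) (μ : Measure ℝ) [SFinite μ] (E : ℝ → ℝ≥0∞) (hE : Measurable E) 
    (hEG : ∀ t, E t = ENNReal.ofReal (1 + G t)) (t : ℝ) : 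
    (μ.withDensity E) (Iic t) * ENNReal.ofReal (1 / (1 + G t)) + 
      ∫⁻ s in Iic t, (μ.withDensity E) (Iic s) * ENNReal.ofReal (z s / (1 + G s) / (1 + G s)) = μ (Iic t) := by
  have hzm := P.meas
  have hGm := P.cont.measurable
  have hinn : ∀ s, 0 ≤ z s / (1 + G s) / (1 + G s) := fun s => 
    (div_nonneg (div_nonneg (P.nn s) (P.e_pos s).le) (P.e_pos s).le)
  set ρ := μ.withDensity E with hρ
  have h1 : ∫⁻ s in Iic t, ρ (Iic s) * ENNReal.ofReal (z s / (1 + G s) / (1 + G s)) = 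
      ∫⁻ u in Iic t, ENNReal.ofReal (1 / (1 + G u) - 1 / (1 + G t)) ∂ρ := by
    set F : ℝ → ℝ → ℝ≥0∞ := fun s u => {p : ℝ × ℝ | p.2 ≤ p.1 ∧ p.1 ≤ t}.indicator 
      (fun p => ENNReal.ofReal (z p.1 / (1 + G p.1) / (1 + G p.1))) (s, u) with hF
    have hFm : Measurable (Function.uncurry F) := by
      refine Measurable.indicator (by fun_prop) ?_
      exact (measurableSet_le measurable_snd measurable_fst).inter (measurableSet_le measurable_fst measurable_const)
    calc _ = ∫⁻ s, ∫⁻ u, F s u ∂ρ := by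
          rw [← lintegral_indicator measurableSet_Iic]
          refine lintegral_congr fun s => ?_
          by_cases hs : s ≤ t
          · simp only [indicator, mem_Iic, hs, if_true, hF, mem_ofPred_eq, and_true]
            rw [mul_comm, ← setLIntegral_const, ← lintegral_indicator measurableSet_Iic]
            rfl
          · simp [indicator, hF, hs]
      _ = ∫⁻ u, ∫⁻ s, F s u ∂volume ∂ρ := lintegral_lintegral_swap hFm.aemeasurable
      _ = _ := by
          rw [← lintegral_indicator measurableSet_Iic]
          refine lintegral_congr fun u => ?_
          by_cases hu : u ≤ t
          · simp only [indicator, mem_Iic, hu, if_true, hF, mem_ofPred_eq]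
            rw [← P.inv_eq, intervalIntegral.integral_of_le hu, 
              ofReal_integral_eq_lintegral_ofReal (P.inv_int u t).1 (ae_of_all _ hinn), 
              setLIntegral_congr Ioc_ae_eq_Icc,
              ← lintegral_indicator measurableSet_Icc]
            simp only [indicator, mem_Icc]
          · simp only [indicator, mem_Iic, hu, if_false, hF, mem_ofPred_eq]
            rw [lintegral_congr (g := fun _ => 0)]
            · simp
            · intro s
              rw [if_neg]
              rintro ⟨a, b⟩
              exact hu (a.trans b)
  rw [h1, mul_comm, ← setLIntegral_const, ← lintegral_add_left measurable_const, 
    setLIntegral_congr_fun (g := fun u => ENNReal.ofReal (1 / (1 + G u))) measurableSet_Iic]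
  · rw [hρ, setLIntegral_withDensity_eq_setLIntegral_mul _ hE (by fun_prop) measurableSet_Iic, ← setLIntegral_one]
    refine lintegral_congr fun u => ?_
    have := P.e_pos u
    simp only [Pi.mul_apply, hEG]
    rw [← ENNReal.ofReal_mul this.le, mul_one_div_cancel this.ne', ENNReal.ofReal_one]
  · intro u hu
    have hu : u ≤ t := hu
    have h2 : 0 ≤ 1 / (1 + G u) - 1 / (1 + G t) := by
      rw [← P.inv_eq]; exact intervalIntegral.integral_nonneg hu fun s _ => hinn s
    simp only
    rw [← ENNReal.ofReal_add (by have := P.e_pos t; positivity) h2]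
    congr 1; ring

/-- the ENNReal version of the nonlinear operator -/
noncomputable def RR (c : ℝ) (n : Measure ℝ) (v I : ℝ → ℝ) (s : ℝ) : ℝ≥0∞ :=
  ENNReal.ofReal (c * v s ^ 2) + ∫⁻ y, ENNReal.ofReal (rexp (-(I s - I (s - y))) - 1 + (I s - I (s - y))) ∂n

lemma RR_meas (c : ℝ) (n : Measure ℝ) [SFinite n] {v I : ℝ → ℝ} (P : Prim v I) : Measurable (RR c n v I) := by
  unfold RR
  have := P.meas
  have h2 := P.cont.measurable
  have h4 : Measurable fun s => ∫⁻ y, ENNReal.ofReal (rexp (-(I s - I (s - y))) - 1 + (I s - I (s - y))) ∂n :=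
    Measurable.lintegral_prod_left' (f := fun p : ℝ × ℝ => 
    ENNReal.ofReal (rexp (-(I p.2 - I (p.2 - p.1))) - 1 + (I p.2 - I (p.2 - p.1)))) (by fun_prop)
  fun_prop

lemma kg_ident (b c : ℝ) (hc : 0 < c) (n : Measure ℝ) [SFinite n] (hn : ∀ᵐ y ∂n, 0 < y) {g G : ℝ → ℝ} (P : Prim g G) (t : ℝ) :
    kg b c n g G t * ENNReal.ofReal (1 / (1 + G t)) + 
      ∫⁻ s in Iic t, kg b c n g G s * ENNReal.ofReal (g s / (1 + G s) / (1 + G s)) = 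
    kg b c n (fun t => g t / (1 + G t)) (fun t => Real.log (1 + G t)) t + 
      ∫⁻ s in Iic t, RR c n (fun t => g t / (1 + G t)) (fun t => Real.log (1 + G t)) s := by
  have hm := P.meas
  have hGm := P.cont.measurable
  have hep := P.e_pos
  have hNm := P.NN_cont.measurable
  set A := ENNReal.ofReal (1 / (1 + G t)) with hA
  set q : ℝ → ℝ≥0∞ := fun s => ENNReal.ofReal (g s / (1 + G s) / (1 + G s)) with hq
  have hqm : Measurable q := by fun_prop
  have hYm : Measurable fun t => ∫⁻ y, ENNReal.ofReal (NN G y t) ∂n :=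
    Measurable.lintegral_prod_left' (f := fun p : ℝ × ℝ => ENNReal.ofReal (NN G p.1 p.2)) (by fun_prop)
  have hC1 : ENNReal.ofReal c * ENNReal.ofReal (g t) * A = ENNReal.ofReal c * ENNReal.ofReal (g t / (1 + G t)) := by
    rw [mul_assoc, hA, ← ENNReal.ofReal_mul (P.nn t)]
    congr 2; ring
  have hC2 : ∀ s, ENNReal.ofReal c * ENNReal.ofReal (g s) * q s = ENNReal.ofReal (c * (g s / (1 + G s)) ^ 2) := by
    intro s
    rw [hq, ← ENNReal.ofReal_mul hc.le, ← ENNReal.ofReal_mul (mul_nonneg hc.le (P.nn s))]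
    congr 1
    ring
  have hB : ENNReal.ofReal b * ENNReal.ofReal (G t) * A + ∫⁻ s in Iic t, ENNReal.ofReal b * ENNReal.ofReal (G s) * q s
      = ENNReal.ofReal b * ENNReal.ofReal (Real.log (1 + G t)) := by
    simp_rw [mul_assoc]
    rw [lintegral_const_mul _ (by fun_prop), ← mul_add, ← P.b_ident t]
    congr 2
    · rw [hA, ← ENNReal.ofReal_mul (P.nonneg t)]
      congr 1; ring
    · refine lintegral_congr fun s => ?_
      rw [hq, ← ENNReal.ofReal_mul (P.nonneg s)]
  have hY : (∫⁻ y, ENNReal.ofReal (NN G y t) ∂n) * A + ∫⁻ s in Iic t, (∫⁻ y, ENNReal.ofReal (NN G y s) ∂n) * q s = 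
      (∫⁻ y, ENNReal.ofReal (NN (fun t => Real.log (1 + G t)) y t) ∂n) + 
      ∫⁻ s in Iic t, ∫⁻ y, ENNReal.ofReal (rexp (-(Real.log (1 + G s) - Real.log (1 + G (s - y)))) - 1 
      + (Real.log (1 + G s) - Real.log (1 + G (s - y)))) ∂n := by
    have m1 : ∀ s, Measurable fun y => ENNReal.ofReal (NN G y s) := fun s => by 
      exact (hNm.comp (by fun_prop : Measurable fun y : ℝ => (y, s))).ennreal_ofReal
    have m2 : Measurable fun y => ENNReal.ofReal (NN (fun t => Real.log (1 + G t)) y t) := 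
      (P.log_prim.NN_cont.measurable.comp (by fun_prop : Measurable fun y : ℝ => (y, t))).ennreal_ofReal
    rw [← lintegral_mul_const _ (m1 t)]
    simp_rw [← lintegral_mul_const _ (m1 _)]
    have s1 : ∫⁻ s in Iic t, ∫⁻ y, ENNReal.ofReal (NN G y s) * q s ∂n = 
        ∫⁻ y, ∫⁻ s in Iic t, ENNReal.ofReal (NN G y s) * q s ∂volume ∂n := by
      rw [lintegral_lintegral_swap]
      refine Measurable.aemeasurable (Measurable.mul ?_ (hqm.comp measurable_fst))
      exact (hNm.comp (by fun_prop : Measurable fun p : ℝ × ℝ => (p.2, p.1))).ennreal_ofReal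
    have s2 : ∫⁻ s in Iic t, ∫⁻ y, ENNReal.ofReal (rexp (-(Real.log (1 + G s) - Real.log (1 + G (s - y)))) - 1 
      + (Real.log (1 + G s) - Real.log (1 + G (s - y)))) ∂n = ∫⁻ y, ∫⁻ s in Iic t, ENNReal.ofReal (rexp (-(Real.log (1 + G s) - Real.log (1 + G (s - y)))) - 1 
      + (Real.log (1 + G s) - Real.log (1 + G (s - y)))) ∂volume ∂n := by
      rw [lintegral_lintegral_swap]
      exact Measurable.aemeasurable (by simp only [Function.uncurry_def]; fun_prop)
    rw [s1, s2, ← lintegral_add_left ((m1 t).mul_const _), ← lintegral_add_left m2]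
    refine lintegral_congr_ae ?_
    filter_upwards [hn] with y hy
    rw [← P.y_ident y t hy]
    congr 1
    · rw [hA, ← ENNReal.ofReal_mul (P.NN_nonneg y t hy)]
      congr 1; ring
    · refine lintegral_congr fun s => ?_
      rw [hq, ← ENNReal.ofReal_mul (P.NN_nonneg y s hy)]
  unfold kg RR
  simp_rw [add_mul]
  rw [lintegral_add_left (by fun_prop), lintegral_add_left (by fun_prop), lintegral_add_left (by fun_prop), 
    hC1, lintegral_congr hC2, ← hB]
  calc _ = ENNReal.ofReal c * ENNReal.ofReal (g t / (1 + G t)) + 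
      (∫⁻ s in Iic t, ENNReal.ofReal (c * (g s / (1 + G s)) ^ 2)) + 
      (ENNReal.ofReal b * ENNReal.ofReal (G t) * A + ∫⁻ s in Iic t, ENNReal.ofReal b * ENNReal.ofReal (G s) * q s) + 
      ((∫⁻ y, ENNReal.ofReal (NN G y t) ∂n) * A + ∫⁻ s in Iic t, (∫⁻ y, ENNReal.ofReal (NN G y s) ∂n) * q s) := by ring
    _ = _ := by rw [hY]; ring

end

section

lemma conv_fin {c : ℝ} {w : ℝ → ℝ} (K : Ker c w) (ρ : Measure ℝ) [SFinite ρ] (hρ0 : ρ (Iio 0) = 0)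
    (hρ : ∀ t, ρ (Iic t) ≠ ⊤) (t : ℝ) : ((wm w).conv ρ) (Iic t) ≠ ⊤ := by
  have hc := K.hc
  rw [conv_Iic]
  have : ∫⁻ s, wm w (Iic (t - s)) ∂ρ ≤ ∫⁻ s, (Iic t).indicator (fun _ => ENNReal.ofReal (t / c)) s ∂ρ := by
    refine lintegral_mono_ae ?_
    have : ∀ᵐ s ∂ρ, 0 ≤ s := by
      rw [ae_iff]; simpa [Iio] using hρ0
    filter_upwards [this] with s hs
    refine (K.wt_le _).trans ?_
    by_cases h : s ≤ t
    · simp only [indicator, mem_Iic, h, if_true]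
      gcongr; linarith
    · push Not at h
      rw [ENNReal.ofReal_of_nonpos (div_nonpos_of_nonpos_of_nonneg (by linarith) K.hc.le)]
      exact zero_le
  refine ne_top_of_le_ne_top ?_ this
  rw [lintegral_indicator_const measurableSet_Iic]
  exact ENNReal.mul_ne_top (by simp) (hρ t)

lemma prim_Z {c : ℝ} {w : ℝ → ℝ} (K : Ker c w) (μ : Measure ℝ) [SFinite μ] (hμ0 : μ (Iio 0) = 0)
    (hμ : ∀ t, μ (Iic t) ≠ ⊤) : 
    Prim (fun t => (ZZ w μ t).toReal) (fun t => (EE w μ t).toReal - 1) := by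
  have hm := K.meas
  have hρ := rho_fin K μ hμ0 hμ
  have hZm : Measurable (ZZ w μ) := cv_meas (by fun_prop) _
  have hZf : ∀ t, ZZ w μ t ≠ ⊤ := fun t => K.cv_fin _ hρ t
  have hneg : ∀ t < 0, (ZZ w μ t).toReal = 0 := by
    intro t ht
    have h1 := K.cv_le (μ.withDensity (EE w μ)) t
    have h2 : (μ.withDensity (EE w μ)) (Iic t) = 0 := by
      refine measure_mono_null (Iic_subset_Iio.2 ht) (withDensity_absolutelyContinuous _ _ hμ0)
    rw [h2, mul_zero, nonpos_iff_eq_zero] at h1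
    simp [ZZ, h1]
  have hof : ∀ t, ENNReal.ofReal (ZZ w μ t).toReal = ZZ w μ t := fun t => ENNReal.ofReal_toReal (hZf t)
  have hfin : ∀ t, ∫⁻ s in Iic t, ZZ w μ s ≠ ⊤ := by
    intro t
    have := EE_fin K μ hμ0 hμ t
    rw [EE_Z K] at this
    exact fun h => this (by simp [h])
  have hint : ∀ a b, IntervalIntegrable (fun t => (ZZ w μ t).toReal) volume a b := by
    have : ∀ t, IntegrableOn (fun t => (ZZ w μ t).toReal) (Iic t) := fun t =>
      integrable_toReal_of_lintegral_ne_top hZm.aemeasurable (hfin t)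
    intro a b
    exact ⟨(this b).mono_set (fun x hx => hx.2), (this a).mono_set (fun x hx => hx.2)⟩
  refine ⟨hneg, fun t => ENNReal.toReal_nonneg, hZm.ennreal_toReal, ?_, hint, ?_⟩
  · intro t
    have := (K.cadlag _ hρ t).1
    simp_rw [← K.cv_toReal] at this
    exact this
  · intro t
    have h1 := lint_Iic hneg (fun t => ENNReal.toReal_nonneg) hint t
    simp_rw [hof] at h1
    have h2 := EE_Z K μ t
    rcases le_total t 0 with h | h
    · rw [EE_nonpos K μ hμ0 t h]
      rw [intervalIntegral.integral_symm, intervalIntegral.integral_of_le h, 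
        setIntegral_congr_set Ioo_ae_eq_Ioc.symm,
        setIntegral_eq_zero_of_forall_eq_zero (fun s hs => hneg s hs.2)]
      simp
    · rw [h2, h1, ENNReal.toReal_add (by simp) (by simp), ENNReal.toReal_ofReal 
        (intervalIntegral.integral_nonneg h fun s _ => ENNReal.toReal_nonneg)]
      simp

lemma main_exist {b c : ℝ} {w : ℝ → ℝ} (K : Ker c w) (n : Measure ℝ) [SFinite n] (hn : ∀ᵐ y ∂n, 0 < y)
    (hkk : (kk b c n).conv (wm w) = ell) (μ : Measure ℝ) [SFinite μ] (hμ0 : μ (Iio 0) = 0)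
    (hμ : ∀ t, μ (Iic t) ≠ ⊤) : ∃ v I, Prim v I ∧ 
    (∀ t, ∃ l, Tendsto v (𝓝[<] t) (𝓝 l)) ∧ 
    (∀ t, (volume.withDensity (RR c n v I)) (Iic t) ≠ ⊤) ∧ 
    ∀ t, ∫ s, w (t - s) ∂μ = v t + ∫ s, w (t - s) ∂(volume.withDensity (RR c n v I)) := by
  have hm := K.meas
  have P := prim_Z K μ hμ0 hμ
  set z := fun t => (ZZ w μ t).toReal with hz
  set G := fun t => (EE w μ t).toReal - 1 with hG
  have hρ := rho_fin K μ hμ0 hμ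
  have Q := P.log_prim
  set v := fun t => z t / (1 + G t) with hv
  set I := fun t => Real.log (1 + G t) with hI
  have hwz : wm z = (wm w).conv (μ.withDensity (EE w μ)) := by
    unfold wm
    rw [conv_dens (by fun_prop)]
    congr 1
    ext t
    exact ENNReal.ofReal_toReal (K.cv_fin _ hρ t)
  have h1 : kg b c n z G =ᵐ[volume] fun t => (μ.withDensity (EE w μ)) (Iic t) := by
    rw [← withDensity_eq_iff_of_sigmaFinite (kg_meas b c n P).aemeasurable (meas_Iic _).aemeasurable,
      ← kk_conv b c n hn P, ← ell_conv, hwz, ← hkk, Measure.conv_assoc]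
  have hEG : ∀ t, EE w μ t = ENNReal.ofReal (1 + G t) := by
    intro t
    simp [hG, ENNReal.ofReal_toReal (EE_fin K μ hμ0 hμ t)]
  have h2 : ∀ᵐ t, kg b c n v I t + ∫⁻ s in Iic t, RR c n v I s = μ (Iic t) := by
    filter_upwards [h1] with t ht
    rw [← kg_ident b c K.hc n hn P t, ← parts P μ (EE w μ) (EE_meas w μ) hEG t, ht]
    congr 1
    refine lintegral_congr_ae (ae_restrict_of_ae ?_)
    filter_upwards [h1] with s hs
    rw [hs]
  have hRm := RR_meas c n Q
  set R := volume.withDensity (RR c n v I) with hR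
  have hRf : ∀ t, R (Iic t) ≠ ⊤ := by
    intro t
    obtain ⟨u, -, hu1, hu2, -⟩ := seq_right h2 t
    refine ne_top_of_le_ne_top (hμ (u 0)) ?_
    rw [← hu2 0]
    refine le_trans (measure_mono (Iic_subset_Iic.2 (hu1 0).le)) ?_
    rw [hR, withDensity_apply _ measurableSet_Iic]
    exact le_add_self
  have hR0 : R (Iio 0) = 0 := by
    rw [hR, withDensity_apply _ measurableSet_Iio, setLIntegral_congr_fun (g := fun _ => 0) measurableSet_Iio]
    · simp
    · intro s hs
      have hs : s < 0 := hs
      simp only [RR]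
      rw [lintegral_congr_ae (g := fun _ => 0), Q.neg s hs]
      · simp
      · filter_upwards [hn] with y hy
        rw [Q.nonpos s hs.le, Q.nonpos (s - y) (by linarith)]
        simp
  have h3 : ell.conv μ = (kk b c n).conv (wm v) + ell.conv R := by
    rw [ell_conv, ell_conv, kk_conv b c n hn Q, ← withDensity_add_left (kg_meas b c n Q)]
    refine withDensity_congr_ae ?_
    filter_upwards [h2] with t ht
    rw [← ht, Pi.add_apply, hR, withDensity_apply _ measurableSet_Iic]
  have h4 : (wm w).conv μ = wm v + (wm w).conv R := by
    refine ell_cancel (conv_fin K μ hμ0 hμ) ?_ ?_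
    · intro t
      rw [Measure.add_apply, Q.wm_Iic]
      exact ENNReal.add_ne_top.2 ⟨by simp, conv_fin K R hR0 hRf t⟩
    · have e : ∀ ρ : Measure ℝ, SFinite ρ → ell.conv ((wm w).conv ρ) = (wm w).conv (ell.conv ρ) := by
        intro ρ _
        rw [← Measure.conv_assoc, Measure.conv_comm ell, Measure.conv_assoc]
      rw [e μ inferInstance, h3, Measure.conv_add, Measure.conv_add, e R inferInstance, ← Measure.conv_assoc, 
        Measure.conv_comm (wm w), hkk]
  have h5 : ∀ᵐ t, ∫ s, w (t - s) ∂μ = v t + ∫ s, w (t - s) ∂(R) := by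
    have hvm := Q.meas
    have hwm : Measurable fun x => ENNReal.ofReal (w x) := by fun_prop
    have h6 := h4
    unfold wm at h6
    rw [conv_dens hwm, conv_dens hwm, ← withDensity_add_left (by fun_prop), withDensity_eq_iff_of_sigmaFinite
      (cv_meas hwm _).aemeasurable ((hvm.ennreal_ofReal.add (cv_meas hwm _)).aemeasurable)] at h6
    filter_upwards [h6] with t ht
    rw [← K.cv_toReal, ← K.cv_toReal, ht, Pi.add_apply, ENNReal.toReal_add (by simp) (K.cv_fin _ hRf t), 
      ENNReal.toReal_ofReal (Q.nn t)]
  refine ⟨v, I, Q, ?_, hRf, ?_⟩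
  · intro t
    obtain ⟨l, hl⟩ := (K.cadlag _ hρ t).2
    simp_rw [← K.cv_toReal] at hl
    refine ⟨l / (1 + G t), Tendsto.div hl ?_ (P.e_pos t).ne'⟩
    exact ((P.cont.tendsto t).const_add 1).mono_left nhdsWithin_le_nhds
  · intro t
    obtain ⟨u, -, hu1, hu2, hu3⟩ := seq_right h5 t
    have hu : Tendsto u atTop (𝓝[≥] t) := tendsto_nhdsWithin_iff.2 ⟨hu3, Eventually.of_forall fun k => (hu1 k).le⟩
    refine tendsto_nhds_unique ((K.cadlag μ hμ t).1.tendsto.comp hu) ?_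
    have := ((Q.right t).tendsto.comp hu).add ((K.cadlag R hRf t).1.tendsto.comp hu)
    refine this.congr fun k => (hu2 k).symm

end

section

lemma Rop_nonneg (c : ℝ) (hc : 0 < c) (ν : Measure ℝ) (f : ℝ → ℝ) (t : ℝ) : 0 ≤ Rop c ν f t := by
  unfold Rop
  refine add_nonneg (by positivity) (integral_nonneg fun y => phi_nonneg _)

lemma mu_int {c : ℝ} {w : ℝ → ℝ} (K : Ker c w) (μ : Measure ℝ) (hμ0 : μ (Iio 0) = 0) (t : ℝ) : 
    ∫ s in Icc (0:ℝ) t, w (t - s) ∂μ = ∫ s, w (t - s) ∂μ := by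
  refine setIntegral_eq_integral_of_ae_compl_eq_zero ?_
  have : ∀ᵐ s ∂μ, 0 ≤ s := by
    rw [ae_iff]; simpa [Iio] using hμ0
  filter_upwards [this] with s hs h
  refine K.neg _ ?_
  by_contra h2
  push Not at h2
  exact h ⟨hs, by linarith⟩

lemma mu_Icc (μ : Measure ℝ) (hμ0 : μ (Iio 0) = 0) (t : ℝ) : μ (Iic t) = μ (Icc 0 t) := by
  refine le_antisymm ?_ (measure_mono Icc_subset_Iic_self)
  calc μ (Iic t) ≤ μ (Iio 0 ∪ Icc 0 t) := by
        refine measure_mono fun x hx => ?_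
        rcases lt_or_ge x 0 with h | h
        · exact Or.inl h
        · exact Or.inr ⟨h, hx⟩
    _ ≤ _ := (measure_union_le _ _).trans (by rw [hμ0, zero_add])

lemma sol_le {c : ℝ} {w : ℝ → ℝ} (K : Ker c w) (ν μ : Measure ℝ) (hμ0 : μ (Iio 0) = 0)
    (hμ : ∀ t, μ (Iic t) ≠ ⊤) (V : ℝ → ℝ) (t : ℝ) (ht : 0 ≤ t) (hV : V t = volterraRHS c ν μ w V t) : 
    V t ≤ (μ (Icc 0 t)).toReal / c := by
  rw [hV, volterraRHS, mu_int K μ hμ0, ← K.cv_toReal, ← mu_Icc μ hμ0]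
  have h1 : 0 ≤ ∫ s in (0:ℝ)..t, Rop c ν V s * w (t - s) := 
    intervalIntegral.integral_nonneg ht fun s _ => mul_nonneg (Rop_nonneg c K.hc ν V s) (K.nonneg _)
  have h2 := ENNReal.toReal_mono (ENNReal.mul_ne_top (by simp) (hμ t)) (K.cv_le μ t)
  rw [ENNReal.toReal_mul, ENNReal.toReal_ofReal (by have := K.hc; positivity)] at h2
  have h3 : (1 / c) * (μ (Iic t)).toReal = (μ (Iic t)).toReal / c := by ring
  linarith

lemma exist_sol {b c : ℝ} {w : ℝ → ℝ} (K : Ker c w) (ν : Measure ℝ) [SFinite (ν.restrict (Ioi 0))] 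
    (hkk : (kk b c (ν.restrict (Ioi 0))).conv (wm w) = ell) (μ : Measure ℝ) [SFinite μ] (hμ0 : μ (Iio 0) = 0)
    (hμ : ∀ t, μ (Iic t) ≠ ⊤) : ∃ V, CadlagNonneg V ∧ ∀ t, 0 ≤ t → V t = volterraRHS c ν μ w V t := by
  have hn : ∀ᵐ y ∂(ν.restrict (Ioi 0)), 0 < y := ae_restrict_mem measurableSet_Ioi
  obtain ⟨v, I, Q, hl, hRf, heq⟩ := main_exist K (ν.restrict (Ioi 0)) hn hkk μ hμ0 hμ
  have hIc := Q.cont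
  refine ⟨v, ⟨fun t _ => Q.nn t, fun t _ => Q.right t, fun t _ => hl t⟩, fun t ht => ?_⟩
  have hRm := RR_meas c (ν.restrict (Ioi 0)) Q
  have hRt : ∀ᵐ s, RR c (ν.restrict (Ioi 0)) v I s < ⊤ := by
    have : ∀ k : ℕ, ∀ᵐ s, s ∈ Iic (k:ℝ) → RR c (ν.restrict (Ioi 0)) v I s < ⊤ := by
      intro k
      rw [← ae_restrict_iff' measurableSet_Iic]
      refine ae_lt_top hRm ?_
      have := hRf k
      rwa [withDensity_apply _ measurableSet_Iic] at this
    filter_upwards [ae_all_iff.2 this] with s hs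
    obtain ⟨k, hk⟩ := exists_nat_ge s
    exact hs k hk
  have h1 := heq t
  rw [integral_withDensity_eq_integral_toReal_smul hRm hRt] at h1
  rw [volterraRHS, mu_int K μ hμ0, h1, intervalIntegral.integral_of_le ht, 
    ← integral_indicator measurableSet_Ioc]
  have : ∫ s, (RR c (ν.restrict (Ioi 0)) v I s).toReal • w (t - s) = 
      ∫ s, (Ioc 0 t).indicator (fun s => Rop c ν v s * w (t - s)) s := by
    refine integral_congr_ae ?_
    have h0 : ∀ᵐ x : ℝ, x ≠ 0 := by simp [ae_iff]
    filter_upwards [h0, hRt] with s hs hst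
    by_cases h : s ∈ Ioc 0 t
    · rw [indicator_of_mem h, smul_eq_mul]
      congr 1
      unfold RR at hst ⊢
      have hX : ∀ y, 0 < y → ∫ r in (max (s - y) 0)..s, v r = I s - I (s - y) := by
        intro y hy
        rw [Q.sub_eq]
        rcases le_total (s - y) 0 with h2 | h2
        · rw [max_eq_right h2, Q.nonpos _ h2, Q.nonpos 0 le_rfl]
        · rw [max_eq_left h2]
      rw [ENNReal.toReal_add (by simp) (ENNReal.add_lt_top.1 hst).2.ne, ENNReal.toReal_ofReal (by have := K.hc; positivity), 
        Rop]
      congr 1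
      rw [← integral_eq_lintegral_of_nonneg_ae (ae_of_all _ fun y => phi_nonneg _)]
      · refine integral_congr_ae ?_
        filter_upwards [hn] with y hy
        rw [hX y hy]
      · exact Continuous.aestronglyMeasurable (by fun_prop)
    · rw [indicator_of_notMem h]
      by_cases h2 : s < 0
      · have : RR c (ν.restrict (Ioi 0)) v I s = 0 := by
          unfold RR
          rw [lintegral_congr_ae (g := fun _ => 0), Q.neg s h2]
          · simp
          · filter_upwards [hn] with y hy
            rw [Q.nonpos s h2.le, Q.nonpos (s - y) (by linarith)]
            simp
        simp [this]
      · rw [K.neg (t - s)]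
        · simp
        · by_contra h3
          push Not at h2 h3
          exact h ⟨lt_of_le_of_ne h2 (Ne.symm hs), by linarith⟩
  rw [this]
  ring

lemma meas_right {U : ℝ → ℝ} (h : ∀ t, ContinuousWithinAt U (Ici t) t) : Measurable U := by
  have hlim : ∀ t : ℝ, Tendsto (fun n : ℕ => U (((⌊((n:ℝ) + 1) * t⌋ : ℝ) + 1) / ((n:ℝ) + 1))) atTop (𝓝 (U t)) := by
    intro t
    refine (h t).tendsto.comp (tendsto_nhdsWithin_iff.2 ⟨?_, ?_⟩)
    · have h2 : Tendsto (fun n : ℕ => t + 1 / ((n:ℝ) + 1)) atTop (𝓝 t) := by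
        simpa using (tendsto_const_nhds (x := t)).add tendsto_one_div_add_atTop_nhds_zero_nat
      refine tendsto_of_tendsto_of_tendsto_of_le_of_le tendsto_const_nhds h2 ?_ ?_
      · intro n
        have : (0:ℝ) < n + 1 := by positivity
        simp only
        rw [le_div_iff₀ this]
        nlinarith [Int.lt_floor_add_one (((n:ℝ) + 1) * t)]
      · intro n
        have : (0:ℝ) < n + 1 := by positivity
        simp only
        have e : (t + 1 / ((n:ℝ) + 1)) * ((n:ℝ) + 1) = t * ((n:ℝ) + 1) + 1 := by field_simp
        rw [div_le_iff₀ this, e]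
        nlinarith [Int.floor_le (((n:ℝ) + 1) * t)]
    · refine Eventually.of_forall fun n => ?_
      have : (0:ℝ) < n + 1 := by positivity
      change t ≤ _
      rw [le_div_iff₀ this]
      nlinarith [Int.lt_floor_add_one (((n:ℝ) + 1) * t)]
  refine measurable_of_tendsto_metrizable (f := fun (n : ℕ) t => U (((⌊((n:ℝ) + 1) * t⌋ : ℝ) + 1) / ((n:ℝ) + 1))) (fun n => ?_) (tendsto_pi_nhds.2 hlim)
  have m1 : Measurable (fun k : ℤ => U (((k:ℝ) + 1) / ((n:ℝ) + 1))) := measurable_from_top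
  exact m1.comp (Int.measurable_floor.comp (by fun_prop))

lemma phi_lip (m a b : ℝ) (ha : 0 ≤ a) (ham : a ≤ m) (hb : 0 ≤ b) (hbm : b ≤ m) :
    |(rexp (-a) - 1 + a) - (rexp (-b) - 1 + b)| ≤ min 1 m * |a - b| := by
  have := Convex.norm_image_sub_le_of_norm_hasDerivWithin_le (f := fun x => rexp (-x) - 1 + x) (f' := fun x => 1 - rexp (-x)) 
    (s := Icc 0 m) (C := min 1 m) (x := b) (y := a) ?_ ?_ (convex_Icc 0 m) ⟨hb, hbm⟩ ⟨ha, ham⟩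
  · exact this
  · intro x _
    have h1 : HasDerivAt (fun x : ℝ => rexp (-x)) (rexp (-x) * (-1)) x := ((hasDerivAt_id x).neg).exp
    refine ((h1.sub_const 1).add (hasDerivAt_id x)).hasDerivWithinAt.congr_deriv ?_
    ring
  · intro x hx
    have h1 : rexp (-x) ≤ 1 := Real.exp_le_one_iff.2 (by linarith [hx.1])
    rw [Real.norm_of_nonneg (by linarith)]
    refine le_min (by linarith [Real.exp_pos (-x)]) ?_
    linarith [Real.add_one_le_exp (-x), hx.2]

end

section

/-- bounded measurable nonnegative functions -/
structure Bd (M : ℝ) (U : ℝ → ℝ) : Prop where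
  meas : Measurable U
  nn : ∀ t, 0 ≤ U t
  le : ∀ t, U t ≤ M

namespace Bd
variable {M : ℝ} {U : ℝ → ℝ}

lemma M_nonneg (B : Bd M U) : 0 ≤ M := (B.nn 0).trans (B.le 0)

lemma int (B : Bd M U) (a b : ℝ) : IntervalIntegrable U volume a b := by
  refine (intervalIntegrable_const (c := M)).mono_fun B.meas.aestronglyMeasurable (ae_of_all _ fun t => ?_)
  simp only
  rw [Real.norm_of_nonneg (B.nn t), Real.norm_of_nonneg B.M_nonneg]
  exact B.le t

lemma X_cont (B : Bd M U) : Continuous (fun p : ℝ × ℝ => ∫ r in (max (p.1 - p.2) 0)..p.1, U r) := by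
  have h1 : Continuous (fun u => ∫ r in (0:ℝ)..u, U r) := intervalIntegral.continuous_primitive B.int 0
  have h : ∀ p : ℝ × ℝ, ∫ r in (max (p.1 - p.2) 0)..p.1, U r = 
    (∫ r in (0:ℝ)..p.1, U r) - ∫ r in (0:ℝ)..(max (p.1 - p.2) 0), U r := by
    intro p
    rw [intervalIntegral.integral_interval_sub_left (B.int _ _) (B.int _ _)]
  simp_rw [h]
  fun_prop

lemma X_nonneg (B : Bd M U) (s y : ℝ) (hs : 0 ≤ s) (hy : 0 < y) : 0 ≤ ∫ r in (max (s - y) 0)..s, U r :=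
  intervalIntegral.integral_nonneg (max_le (by linarith) hs) fun r _ => B.nn r

lemma X_le (B : Bd M U) (s y : ℝ) (hs : 0 ≤ s) (hy : 0 < y) : ∫ r in (max (s - y) 0)..s, U r ≤ M * y := by
  have h1 : max (s - y) 0 ≤ s := max_le (by linarith) hs
  have h2 : ∫ r in (max (s - y) 0)..s, U r ≤ ∫ r in (max (s - y) 0)..s, M := 
    intervalIntegral.integral_mono_on h1 (B.int _ _) (by simp) fun r _ => B.le r
  rw [intervalIntegral.integral_const, smul_eq_mul] at h2
  have h3 : s - max (s - y) 0 ≤ y := by linarith [le_max_left (s - y) 0]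
  nlinarith [B.M_nonneg]

lemma phi_int (B : Bd M U) {ν : Measure ℝ} 
    (hνint : ∫⁻ y in Set.Ioi (0 : ℝ), ENNReal.ofReal (min y (y ^ 2)) ∂ν ≠ ⊤) (s : ℝ) (hs : 0 ≤ s) :
    IntegrableOn (fun y => rexp (-(∫ r in (max (s - y) 0)..s, U r)) - 1 + ∫ r in (max (s - y) 0)..s, U r) (Ioi 0) ν ∧ 
    (∫ y in Ioi (0:ℝ), (rexp (-(∫ r in (max (s - y) 0)..s, U r)) - 1 + ∫ r in (max (s - y) 0)..s, U r) ∂ν) 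
      ≤ (M + M ^ 2) * ∫ y in Ioi (0:ℝ), min y (y ^ 2) ∂ν := by
  have hX : Continuous fun y => ∫ r in (max (s - y) 0)..s, U r := 
    B.X_cont.comp (by fun_prop : Continuous fun y : ℝ => (s, y))
  have hb : ∀ᵐ y ∂(ν.restrict (Ioi 0)), rexp (-(∫ r in (max (s - y) 0)..s, U r)) - 1 + ∫ r in (max (s - y) 0)..s, U r ≤ 
      (M + M ^ 2) * min y (y ^ 2) := by
    filter_upwards [ae_restrict_mem measurableSet_Ioi] with y hy
    have hy : 0 < y := hy
    have h0 := B.X_nonneg s y hs hy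
    have h1 := B.X_le s y hs hy
    refine (phi_le _ h0).trans (le_trans ?_ (min_scale y M hy B.M_nonneg))
    exact min_le_min h1 (by gcongr)
  have hi : Integrable (fun y => (M + M ^ 2) * min y (y ^ 2)) (ν.restrict (Ioi 0)) := (integrable_min hνint).const_mul _
  have h1 : IntegrableOn (fun y => rexp (-(∫ r in (max (s - y) 0)..s, U r)) - 1 + ∫ r in (max (s - y) 0)..s, U r) (Ioi 0) ν := by
    refine hi.mono' (Continuous.aestronglyMeasurable (by fun_prop)) ?_
    filter_upwards [hb] with y hy
    rwa [Real.norm_of_nonneg (phi_nonneg _)]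
  refine ⟨h1, ?_⟩
  rw [← integral_const_mul]
  exact integral_mono_ae h1 hi hb

lemma Rop_meas (B : Bd M U) (c : ℝ) {ν : Measure ℝ} [SFinite (ν.restrict (Ioi 0))] : Measurable (Rop c ν U) := by
  have hm := B.meas
  have hX := B.X_cont
  unfold Rop
  have h1 : Measurable fun s => ∫ y in Ioi (0:ℝ), (rexp (-(∫ r in (max (s - y) 0)..s, U r)) - 1 + ∫ r in (max (s - y) 0)..s, U r) ∂ν := by
    refine StronglyMeasurable.measurable (StronglyMeasurable.integral_prod_right' (f := fun p : ℝ × ℝ => 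
      rexp (-(∫ r in (max (p.1 - p.2) 0)..p.1, U r)) - 1 + ∫ r in (max (p.1 - p.2) 0)..p.1, U r) ?_)
    exact Continuous.stronglyMeasurable (by fun_prop)
  fun_prop

lemma Rop_int (B : Bd M U) {c : ℝ} {w : ℝ → ℝ} (K : Ker c w) {ν : Measure ℝ} [SFinite (ν.restrict (Ioi 0))]
    (hνint : ∫⁻ y in Set.Ioi (0 : ℝ), ENNReal.ofReal (min y (y ^ 2)) ∂ν ≠ ⊤) (t : ℝ) (ht : 0 ≤ t) :
    IntervalIntegrable (fun s => Rop c ν U s * w (t - s)) volume 0 t := by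
  have hm := B.Rop_meas c (ν := ν)
  have hwm := K.meas
  have hc := K.hc
  have hM := B.M_nonneg
  set C := c * M ^ 2 + (M + M ^ 2) * ∫ y in Ioi (0:ℝ), min y (y ^ 2) ∂ν with hC
  rw [intervalIntegrable_iff_integrableOn_Ioc_of_le ht]
  refine Integrable.mono' (g := fun _ => C * (1 / c)) (integrable_const _) (Measurable.aestronglyMeasurable (by fun_prop)) ?_
  filter_upwards [ae_restrict_mem measurableSet_Ioc] with s hs
  have h0 := Rop_nonneg c K.hc ν U s
  rw [Real.norm_of_nonneg (mul_nonneg h0 (K.nonneg _))]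
  have h1 : Rop c ν U s ≤ C := by
    unfold Rop
    refine add_le_add ?_ (B.phi_int hνint s hs.1.le).2
    have := B.nn s
    have := B.le s
    gcongr
  exact mul_le_mul h1 (K.le _) (K.nonneg _) (h0.trans h1)

lemma Rop_diff {U₂ : ℝ → ℝ} (B : Bd M U) (B₂ : Bd M U₂) {c : ℝ} (hc : 0 < c) {ν : Measure ℝ} 
    (hνint : ∫⁻ y in Set.Ioi (0 : ℝ), ENNReal.ofReal (min y (y ^ 2)) ∂ν ≠ ⊤) (s D : ℝ) (hs : 0 ≤ s) 
    (hD : ∀ r, 0 ≤ r → r ≤ s → |U r - U₂ r| ≤ D) :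
    |Rop c ν U s - Rop c ν U₂ s| ≤ (2 * c * M + (1 + M) * ∫ y in Ioi (0:ℝ), min y (y ^ 2) ∂ν) * D := by
  have hM := B.M_nonneg
  have hD0 : 0 ≤ D := (abs_nonneg _).trans (hD s hs le_rfl)
  unfold Rop
  have e : ∀ a b x y : ℝ, (a + x) - (b + y) = (a - b) + (x - y) := by intros; ring
  rw [e, ← integral_sub (B.phi_int hνint s hs).1 (B₂.phi_int hνint s hs).1, add_mul]
  refine (abs_add_le _ _).trans (add_le_add ?_ ?_)
  · have e2 : c * U s ^ 2 - c * U₂ s ^ 2 = c * (U s + U₂ s) * (U s - U₂ s) := by ring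
    have n1 := B.nn s
    have n2 := B₂.nn s
    rw [e2, abs_mul, abs_of_nonneg (by positivity)]
    refine mul_le_mul ?_ (hD s hs le_rfl) (abs_nonneg _) (by positivity)
    have := B.le s
    have := B₂.le s
    nlinarith
  · rw [mul_right_comm, ← integral_const_mul]
    rw [← Real.norm_eq_abs]
    refine (norm_integral_le_of_norm_le ((integrable_min hνint).const_mul _) ?_)
    filter_upwards [ae_restrict_mem measurableSet_Ioi] with y hy
    have hy : 0 < y := hy
    have h1 : max (s - y) 0 ≤ s := max_le (by linarith) hs
    refine (phi_lip (M * y) _ _ (B.X_nonneg s y hs hy) (B.X_le s y hs hy) (B₂.X_nonneg s y hs hy) (B₂.X_le s y hs hy)).trans ?_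
    have h2 : |(∫ r in (max (s - y) 0)..s, U r) - ∫ r in (max (s - y) 0)..s, U₂ r| ≤ D * y := by
      rw [← intervalIntegral.integral_sub (B.int _ _) (B₂.int _ _), ← Real.norm_eq_abs]
      refine (intervalIntegral.norm_integral_le_of_norm_le_const (C := D) ?_).trans ?_
      · intro r hr
        rw [uIoc_of_le h1] at hr
        exact hD r ((le_max_right _ _).trans hr.1.le) hr.2
      · rw [abs_of_nonneg (by linarith)]
        have h3 : s - max (s - y) 0 ≤ y := by linarith [le_max_left (s - y) 0]
        gcongr
    refine (mul_le_mul_of_nonneg_left h2 (le_min zero_le_one (by positivity))).trans ?_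
    have h4 : min 1 (M * y) * y ≤ (1 + M) * min y (y ^ 2) := by
      rcases le_total y (y ^ 2) with h | h
      · rw [min_eq_left h]
        nlinarith [min_le_left 1 (M * y), mul_nonneg hM hy.le]
      · rw [min_eq_right h]
        nlinarith [min_le_right 1 (M * y), sq_nonneg y]
    calc _ = D * (min 1 (M * y) * y) := by ring
      _ ≤ D * ((1 + M) * min y (y ^ 2)) := by gcongr
      _ = _ := by ring

end Bd

lemma contr {M c : ℝ} {w U U₂ : ℝ → ℝ} (B : Bd M U) (B₂ : Bd M U₂) (K : Ker c w) {ν : Measure ℝ} 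
    [SFinite (ν.restrict (Ioi 0))]
    (hνint : ∫⁻ y in Set.Ioi (0 : ℝ), ENNReal.ofReal (min y (y ^ 2)) ∂ν ≠ ⊤) (T : ℝ) (F : ℝ → ℝ)
    (h1 : ∀ t, 0 ≤ t → t ≤ T → U t = F t - ∫ s in (0:ℝ)..t, Rop c ν U s * w (t - s))
    (h2 : ∀ t, 0 ≤ t → t ≤ T → U₂ t = F t - ∫ s in (0:ℝ)..t, Rop c ν U₂ s * w (t - s)) :
    ∀ t, 0 ≤ t → t ≤ T → U t = U₂ t := by
  have hM := B.M_nonneg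
  have hc := K.hc
  have hK : 0 ≤ ∫ y in Ioi (0:ℝ), min y (y ^ 2) ∂ν := 
    setIntegral_nonneg measurableSet_Ioi fun y hy => le_min (le_of_lt hy) (sq_nonneg y)
  set C := 2 * c * M + (1 + M) * ∫ y in Ioi (0:ℝ), min y (y ^ 2) ∂ν with hC
  have hC0 : 0 ≤ C := by positivity
  set l := 2 * (C + 1) / c with hl
  have hl0 : 0 < l := by positivity
  have step : ∀ A, 0 ≤ A → (∀ t, 0 ≤ t → t ≤ T → |U t - U₂ t| ≤ A * rexp (l * t)) → 
      ∀ t, 0 ≤ t → t ≤ T → |U t - U₂ t| ≤ A / 2 * rexp (l * t) := by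
    intro A hA ih t ht htT
    have e : U t - U₂ t = ∫ s in (0:ℝ)..t, (Rop c ν U₂ s * w (t - s) - Rop c ν U s * w (t - s)) := by
      rw [h1 t ht htT, h2 t ht htT, intervalIntegral.integral_sub (B₂.Rop_int K hνint t ht) (B.Rop_int K hνint t ht)]
      ring
    rw [e]
    have hb : ‖∫ s in (0:ℝ)..t, (Rop c ν U₂ s * w (t - s) - Rop c ν U s * w (t - s))‖ ≤ 
        ∫ s in (0:ℝ)..t, C * A / c * rexp (l * s) := by
      refine intervalIntegral.norm_integral_le_of_norm_le ht ?_ (Continuous.intervalIntegrable (by fun_prop) _ _)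
      refine ae_of_all _ fun s hs => ?_
      have := B₂.Rop_diff B hc hνint s (A * rexp (l * s)) hs.1.le (fun r hr hrs => by
        rw [abs_sub_comm]
        refine (ih r hr (by linarith [hs.2])).trans ?_
        gcongr)
      rw [← sub_mul, norm_mul, Real.norm_of_nonneg (K.nonneg _)]
      refine (mul_le_mul this (K.le _) (K.nonneg _) (by positivity)).trans (le_of_eq ?_)
      ring
    refine hb.trans ?_
    have hint : ∫ s in (0:ℝ)..t, C * A / c * rexp (l * s) = C * A / c * ((rexp (l * t) - 1) / l) := by
      rw [intervalIntegral.integral_const_mul]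
      congr 1
      rw [intervalIntegral.integral_comp_mul_left (fun x => rexp x) hl0.ne', integral_exp]
      simp [div_eq_inv_mul]
    rw [hint]
    have h3 : C * A / c * ((rexp (l * t) - 1) / l) = (C / (C + 1)) * (A / 2 * (rexp (l * t) - 1)) := by
      rw [hl]; field_simp
    rw [h3]
    have h4 : C / (C + 1) ≤ 1 := by rw [div_le_one (by positivity)]; linarith
    have h5 : 1 ≤ rexp (l * t) := Real.one_le_exp (by positivity)
    calc _ ≤ 1 * (A / 2 * (rexp (l * t) - 1)) := by 
          refine mul_le_mul_of_nonneg_right h4 (mul_nonneg (by positivity) (by linarith))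
      _ ≤ _ := by nlinarith
  have all : ∀ k : ℕ, ∀ t, 0 ≤ t → t ≤ T → |U t - U₂ t| ≤ M * (1 / 2) ^ k * rexp (l * t) := by
    intro k
    induction k with
    | zero => 
      intro t ht _
      have h5 : 1 ≤ rexp (l * t) := Real.one_le_exp (by positivity)
      have : |U t - U₂ t| ≤ M := by
        rw [abs_le]
        constructor <;> linarith [B.nn t, B.le t, B₂.nn t, B₂.le t]
      simp only [pow_zero, mul_one]
      nlinarith
    | succ k ih =>
      intro t ht htT
      refine (step _ (by positivity) ih t ht htT).trans (le_of_eq ?_)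
      rw [pow_succ]; ring
  intro t ht htT
  have hlim : Tendsto (fun k : ℕ => M * (1 / 2 : ℝ) ^ k * rexp (l * t)) atTop (𝓝 0) := by
    have := ((tendsto_pow_atTop_nhds_zero_of_lt_one (r := (1 / 2 : ℝ)) (by norm_num) (by norm_num)).const_mul M).mul_const (rexp (l * t))
    simpa using this
  have := ge_of_tendsto' hlim (fun k => all k t ht htT)
  have := abs_eq_zero.1 (le_antisymm this (abs_nonneg _))
  linarith

lemma uniq_sol {c : ℝ} {w : ℝ → ℝ} (K : Ker c w) {ν : Measure ℝ} [SFinite (ν.restrict (Ioi 0))]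
    (hνint : ∫⁻ y in Set.Ioi (0 : ℝ), ENNReal.ofReal (min y (y ^ 2)) ∂ν ≠ ⊤) (μ : Measure ℝ) (hμ0 : μ (Iio 0) = 0)
    (hμ : ∀ t, μ (Iic t) ≠ ⊤) (V V₂ : ℝ → ℝ) (hc1 : CadlagNonneg V) (hc2 : CadlagNonneg V₂)
    (h1 : ∀ t, 0 ≤ t → V t = volterraRHS c ν μ w V t) (h2 : ∀ t, 0 ≤ t → V₂ t = volterraRHS c ν μ w V₂ t) 
    (T : ℝ) (hT : 0 ≤ T) : V₂ T = V T := by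
  have hc := K.hc
  set M := (μ (Icc 0 T)).toReal / c with hM
  have hM0 : 0 ≤ M := by positivity
  have key : ∀ V : ℝ → ℝ, CadlagNonneg V → (∀ t, 0 ≤ t → V t = volterraRHS c ν μ w V t) → 
      ∃ U, Bd M U ∧ (∀ t, 0 ≤ t → t ≤ T → U t = V t) ∧ 
      ∀ t, 0 ≤ t → t ≤ T → U t = (∫ s in Set.Icc (0 : ℝ) t, w (t - s) ∂μ) - ∫ s in (0:ℝ)..t, Rop c ν U s * w (t - s) := by
    intro V hV hE
    have hle : ∀ t, 0 ≤ t → t ≤ T → V t ≤ M := by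
      intro t ht htT
      refine (sol_le K ν μ hμ0 hμ V t ht (hE t ht)).trans ?_
      rw [hM]
      have := ENNReal.toReal_mono (mu_Icc μ hμ0 T ▸ hμ T) (measure_mono (μ := μ) (Icc_subset_Icc_right htT : Icc 0 t ⊆ Icc 0 T))
      gcongr
    have hm : Measurable fun t => V (max t 0) := by
      refine meas_right fun t => ?_
      refine ContinuousWithinAt.comp (t := Ici (max t 0)) (hV.2.1 (max t 0) (le_max_right _ _)) 
        (Continuous.continuousWithinAt (by fun_prop)) ?_
      intro x hx
      exact max_le_max_right 0 (mem_Ici.1 hx)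
    set U := (Icc 0 T).indicator (fun t => V (max t 0)) with hU
    have hUV : ∀ t, 0 ≤ t → t ≤ T → U t = V t := by
      intro t ht htT
      rw [hU, indicator_of_mem (show t ∈ Icc 0 T from ⟨ht, htT⟩), max_eq_left ht]
    refine ⟨U, ⟨hm.indicator measurableSet_Icc, ?_, ?_⟩, hUV, ?_⟩
    · intro t
      exact indicator_nonneg (fun t _ => hV.1 _ (le_max_right _ _)) t
    · intro t
      by_cases h : t ∈ Icc 0 T
      · rw [hUV t h.1 h.2]; exact hle t h.1 h.2
      · rw [hU, indicator_of_notMem h]; exact hM0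
    · intro t ht htT
      rw [hUV t ht htT, hE t ht, volterraRHS]
      congr 1
      refine intervalIntegral.integral_congr fun s hs => ?_
      rw [uIcc_of_le ht] at hs
      congr 1
      unfold Rop
      rw [hUV s hs.1 (hs.2.trans htT)]
      congr 1
      refine setIntegral_congr_fun measurableSet_Ioi fun y hy => ?_
      have hy : 0 < y := hy
      have hX : ∫ r in (max (s - y) 0)..s, V r = ∫ r in (max (s - y) 0)..s, U r := by
        refine intervalIntegral.integral_congr fun r hr => ?_
        rw [uIcc_of_le (max_le (by linarith) hs.1)] at hr
        exact (hUV r ((le_max_right _ _).trans hr.1) (hr.2.trans (hs.2.trans htT))).symm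
      simp only [hX]
  obtain ⟨U, B, e1, f1⟩ := key V hc1 h1
  obtain ⟨U₂, B₂, e2, f2⟩ := key V₂ hc2 h2
  rw [← e1 T hT le_rfl, ← e2 T hT le_rfl]
  exact (contr B B₂ K hνint T _ f1 f2 T hT le_rfl).symm

end

/-- Lemma 7.4: if the nonlinear Volterra equation admits an `L^∞_loc`-noncontinuable
solution, then it admits a unique nonnegative càdlàg global solution, bounded by
`μ([0,t])/c`. -/
theorem stmt18
    (b c : ℝ) (hb : 0 ≤ b) (hc : 0 < c)
    (ν : Measure ℝ) (hν0 : ν (Set.Iic 0) = 0)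
    (hνint : ∫⁻ y in Set.Ioi (0 : ℝ), ENNReal.ofReal (min y (y ^ 2)) ∂ν ≠ ⊤)
    (W W' : ℝ → ℝ)
    (hWneg : ∀ x : ℝ, x < 0 → W x = 0)
    (hWnonneg : ∀ x : ℝ, 0 ≤ W x)
    (hWcont : ContinuousOn W (Set.Ici 0))
    (hWmono : StrictMonoOn W (Set.Ici 0))
    (hWlap : ∀ l : ℝ, 0 < l →
      (∫ x in Set.Ioi (0 : ℝ), Real.exp (-l * x) * W x) = 1 / phi b c ν l)
    (hW'neg : ∀ x : ℝ, x < 0 → W' x = 0)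
    (hW'zero : W' 0 = 1 / c)
    (hW'deriv : ∀ x : ℝ, 0 < x → HasDerivAt W (W' x) x)
    (hW'cont : ContinuousOn W' (Set.Ici 0))
    (μ : Measure ℝ) [SigmaFinite μ] (hμ0 : μ (Set.Iio 0) = 0)
    (hμfin : ∀ t : ℝ, 0 ≤ t → μ (Set.Icc 0 t) ≠ ⊤)
    (hex : ∃ (V : ℝ → ℝ) (Tinf : ℝ≥0∞), 0 < Tinf ∧
      (∀ T : ℝ, 0 ≤ T → ENNReal.ofReal T < Tinf →
        ∃ M : ℝ, ∀ᵐ t ∂(volume.restrict (Set.Icc (0 : ℝ) T)), |V t| ≤ M) ∧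
      (∀ᵐ t ∂(volume.restrict {t : ℝ | 0 ≤ t ∧ ENNReal.ofReal t < Tinf}),
        V t = volterraRHS c ν μ W' V t) ∧
      (Tinf ≠ ⊤ →
        ¬ ∃ M : ℝ, ∀ᵐ t ∂(volume.restrict {t : ℝ | 0 ≤ t ∧ ENNReal.ofReal t < Tinf}),
          |V t| ≤ M))
    :
    ∃ V : ℝ → ℝ,
      (CadlagNonneg V ∧
        (∀ t : ℝ, 0 ≤ t → V t = volterraRHS c ν μ W' V t) ∧
        (∀ t : ℝ, 0 ≤ t → V t ≤ (μ (Set.Icc 0 t)).toReal / c)) ∧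
      (∀ V₂ : ℝ → ℝ, CadlagNonneg V₂ →
        (∀ t : ℝ, 0 ≤ t → V₂ t = volterraRHS c ν μ W' V₂ t) →
        ∀ t : ℝ, 0 ≤ t → V₂ t = V t) := by
  obtain ⟨hnn, hkk, hle⟩ := scale_facts b c hb hc ν hνint W W' hWnonneg hWcont hWmono hWlap
    hW'neg hW'zero hW'deriv hW'cont
  haveI := sfinite_nu hνint
  have K : Ker c W' := ⟨hc, hW'neg, hnn, hle, hW'cont⟩
  have hμ : ∀ t, μ (Iic t) ≠ ⊤ := by
    intro t
    rw [mu_Icc μ hμ0 t]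
    rcases le_or_gt 0 t with ht | ht
    · exact hμfin t ht
    · rw [Icc_eq_empty (not_le.mpr ht)]
      simp
  obtain ⟨V, hV, hE⟩ := exist_sol K ν hkk μ hμ0 hμ
  refine ⟨V, ⟨hV, hE, fun t ht => sol_le K ν μ hμ0 hμ V t ht (hE t ht)⟩, ?_⟩
  intro V₂ h2 e2 t ht
  exact uniq_sol K hνint μ hμ0 hμ V V₂ hV h2 hE e2 t ht
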